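/- There exist mixing probability-preserving actions of H₃(ℝ) of Poisson type and of Gaussian type: namely, there is an infinite-measure-preserving action of H₃(ℝ) whose Poisson suspension is a mixing probability-preserving action of H₃(ℝ), and there is a mixing Gaussian probability-preserving action of H₃(ℝ). -/

import Mathlib

open Filter Topology Pointwise

/-- The real Heisenberg group `H₃(ℝ)`: `⟨a, b, c⟩` encodes the upper unitriangular `3 × 3`
matrix with entry `a` at position `(1,2)`, `b` at position `(2,3)` and `c` at position `(1,3)`. -/
@[ext] structure H3 : Type where
  a : ℝ
  b : ℝ
  c : ℝ

namespace H3

instance : Mul H3 := ⟨fun g h => ⟨g.a + h.a, g.b + h.b, g.c + h.c + g.a * h.b⟩⟩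
instance : One H3 := ⟨⟨0, 0, 0⟩⟩
instance : Inv H3 := ⟨fun g => ⟨-g.a, -g.b, g.a * g.b - g.c⟩⟩

@[simp] lemma mul_a (g h : H3) : (g * h).a = g.a + h.a := rfl
@[simp] lemma mul_b (g h : H3) : (g * h).b = g.b + h.b := rfl
@[simp] lemma mul_c (g h : H3) : (g * h).c = g.c + h.c + g.a * h.b := rfl
@[simp] lemma one_a : (1 : H3).a = 0 := rfl
@[simp] lemma one_b : (1 : H3).b = 0 := rfl
@[simp] lemma one_c : (1 : H3).c = 0 := rfl
@[simp] lemma inv_a (g : H3) : g⁻¹.a = -g.a := rfl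
@[simp] lemma inv_b (g : H3) : g⁻¹.b = -g.b := rfl
@[simp] lemma inv_c (g : H3) : g⁻¹.c = g.a * g.b - g.c := rfl

instance : Group H3 where
  mul_assoc g h k := by ext <;> simp <;> ring
  one_mul g := by ext <;> simp
  mul_one g := by ext <;> simp
  inv_mul_cancel g := by ext <;> simp

def toProd (g : H3) : ℝ × ℝ × ℝ := (g.a, g.b, g.c)
def ofProd (p : ℝ × ℝ × ℝ) : H3 := ⟨p.1, p.2.1, p.2.2⟩

/-- The natural (Euclidean) topology of `H₃(ℝ)`. -/
instance : TopologicalSpace H3 := TopologicalSpace.induced toProd inferInstance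
/-- The Borel σ-algebra of `H₃(ℝ)`. -/
instance : MeasurableSpace H3 := MeasurableSpace.comap toProd inferInstance

/-- A Haar measure on `H₃(ℝ)` (Lebesgue measure in the upper-triangular coordinates);
it satisfies `haar (box α β γ) = 8αβγ`. -/
noncomputable def haar : MeasureTheory.Measure H3 :=
  MeasureTheory.Measure.map ofProd MeasureTheory.volume

/-- The one-parameter subgroup `a(t)` (entry `t` at position `(1,2)`). -/
def A (t : ℝ) : H3 := ⟨t, 0, 0⟩
/-- The one-parameter subgroup `b(t)` (entry `t` at position `(2,3)`). -/
def B (t : ℝ) : H3 := ⟨0, t, 0⟩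
/-- The central one-parameter subgroup `c(t)` (entry `t` at position `(1,3)`). -/
def C (t : ℝ) : H3 := ⟨0, 0, t⟩

/-- The flip automorphism `θ` of `H₃(ℝ)`: `θ(a(t)) = b(t)`, `θ(b(t)) = a(t)`, `θ(c(t)) = c(-t)`. -/
def flip (g : H3) : H3 := ⟨g.b, g.a, g.a * g.b - g.c⟩

/-- The box `I(α,β,γ) = {c(t₃)b(t₂)a(t₁) : |t₁| ≤ α, |t₂| ≤ β, |t₃| ≤ γ}`. -/
def box (α β γ : ℝ) : Set H3 := {g : H3 | |g.a| ≤ α ∧ |g.b| ≤ β ∧ |g.c| ≤ γ}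

end H3

/-- A (jointly measurable) measure-preserving action of the Heisenberg group `H₃(ℝ)`
by invertible measure-preserving transformations on a measure space `(X, μ)`. -/
structure H3System : Type 1 where
  X : Type
  [ms : MeasurableSpace X]
  μ : MeasureTheory.Measure X
  T : H3 → X → X
  t_one : ∀ x, T 1 x = x
  t_mul : ∀ g h x, T (g * h) x = T g (T h x)
  t_meas : Measurable fun p : H3 × X => T p.1 p.2
  t_mp : ∀ g, MeasureTheory.MeasurePreserving (T g) μ μ

attribute [instance] H3System.ms

section BaseDefs

open MeasureTheory

variable {Y : Type*} [MeasurableSpace Y]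

/-- Mixing for a family of measure-preserving maps indexed by `H₃(ℝ)`:
`ν (S g A ∩ B) → ν A · ν B` as `g → ∞`. -/
def MixingFam (ν : Measure Y) (S : H3 → Y → Y) : Prop :=
  ∀ A B : Set Y, MeasurableSet A → MeasurableSet B →
    Tendsto (fun g : H3 => ν (S g '' A ∩ B)) (cocompact H3) (𝓝 (ν A * ν B))

/-- Mixing of order `l` (with `l+1` sets) for a family of maps indexed by `H₃(ℝ)`. -/
def MixingOfOrderFam (ν : Measure Y) (S : H3 → Y → Y) (l : ℕ) : Prop :=
  ∀ ε : ℝ, 0 < ε → ∀ A : Fin (l + 1) → Set Y, (∀ i, MeasurableSet (A i)) →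
    ∃ K : Set H3, IsCompact K ∧
      ∀ g : Fin (l + 1) → H3, (∀ i j, i ≠ j → g i * (g j)⁻¹ ∉ K) →
        |(ν (⋂ i, S (g i) '' A i)).toReal - ∏ i, (ν (A i)).toReal| < ε

/-- Mixing for a flow (a family of maps indexed by `ℝ`). -/
def FlowMixingFam (ν : Measure Y) (S : ℝ → Y → Y) : Prop :=
  ∀ A B : Set Y, MeasurableSet A → MeasurableSet B →
    Tendsto (fun t : ℝ => ν (S t '' A ∩ B)) (cocompact ℝ) (𝓝 (ν A * ν B))

/-- Mixing of order `l` (with `l+1` sets) for a flow. -/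
def FlowMixingOfOrderFam (ν : Measure Y) (S : ℝ → Y → Y) (l : ℕ) : Prop :=
  ∀ ε : ℝ, 0 < ε → ∀ A : Fin (l + 1) → Set Y, (∀ i, MeasurableSet (A i)) →
    ∃ K : Set ℝ, IsCompact K ∧
      ∀ t : Fin (l + 1) → ℝ, (∀ i j, i ≠ j → t i - t j ∉ K) →
        |(ν (⋂ i, S (t i) '' A i)).toReal - ∏ i, (ν (A i)).toReal| < ε

namespace H3System

variable (s : H3System)

/-- `(X, ℬ, μ)` is a standard probability space. -/
def IsStdProb : Prop := StandardBorelSpace s.X ∧ IsProbabilityMeasure s.μ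

/-- Freeness: for almost every point, only the identity fixes it. -/
def Free : Prop := ∀ᵐ x ∂s.μ, ∀ g : H3, s.T g x = x → g = 1

/-- Mixing of the whole `H₃(ℝ)`-action. -/
def Mixing : Prop := MixingFam s.μ s.T

/-- Mixing of the central flow `(T_{c(t)})_{t∈ℝ}`. -/
def CentralMixing : Prop := FlowMixingFam s.μ fun t => s.T (H3.C t)

/-- Ergodicity of the central flow `(T_{c(t)})_{t∈ℝ}`. -/
def CentralErgodic : Prop :=
  ∀ A : Set s.X, MeasurableSet A → (∀ t : ℝ, s.T (H3.C t) ⁻¹' A = A) →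
    s.μ A = 0 ∨ s.μ Aᶜ = 0

/-- Rigidity: some sequence `gₙ → ∞` satisfies `μ(T_{gₙ}A ∩ B) → μ(A ∩ B)`. -/
def Rigid : Prop :=
  ∃ g : ℕ → H3, Tendsto g atTop (cocompact H3) ∧
    ∀ A B : Set s.X, MeasurableSet A → MeasurableSet B →
      Tendsto (fun n => s.μ (s.T (g n) '' A ∩ B)) atTop (𝓝 (s.μ (A ∩ B)))

/-- Weak mixing: the diagonal product action on `(X × X, μ × μ)` is ergodic. -/
def WeaklyMixing : Prop :=
  ∀ A : Set (s.X × s.X), MeasurableSet A →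
    (∀ g : H3, (fun p : s.X × s.X => (s.T g p.1, s.T g p.2)) ⁻¹' A = A) →
    (s.μ.prod s.μ) A = 0 ∨ (s.μ.prod s.μ) Aᶜ = 0

/-- Zero type (mixing in infinite measure): `μ(T_g D₁ ∩ D₂) → 0` as `g → ∞`
for sets of finite measure. -/
def ZeroType : Prop :=
  ∀ D₁ D₂ : Set s.X, MeasurableSet D₁ → MeasurableSet D₂ → s.μ D₁ < ⊤ → s.μ D₂ < ⊤ →
    Tendsto (fun g : H3 => s.μ (s.T g '' D₁ ∩ D₂)) (cocompact H3) (𝓝 0)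

end H3System

/-- A (one-sided) Følner sequence of relatively compact subsets of positive finite
Haar measure in `H₃(ℝ)`. -/
def IsFolnerSeq (F : ℕ → Set H3) : Prop :=
  (∀ n, IsCompact (closure (F n)) ∧ 0 < H3.haar (F n) ∧ H3.haar (F n) < ⊤) ∧
  ∀ g : H3,
    Tendsto (fun n => H3.haar (symmDiff ((g * ·) '' F n) (F n)) / H3.haar (F n)) atTop (𝓝 0)

/-- A Rokhlin tower `(Y, f, F)` for the system `s`: `f : Y → F` is measurable and
`f⁻¹(gH) = T_g f⁻¹(H)` for Borel `H ⊆ F` and `g` with `gH ⊆ F`. -/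
def IsRokhlinTower (s : H3System) (Y : Set s.X) (f : s.X → H3) (F : Set H3) : Prop :=
  MeasurableSet Y ∧ Measurable f ∧ (∀ x ∈ Y, f x ∈ F) ∧
  ∀ (H : Set H3) (g : H3), MeasurableSet H → H ⊆ F → (g * ·) '' H ⊆ F →
    Y ∩ f ⁻¹' ((g * ·) '' H) = s.T g '' (Y ∩ f ⁻¹' H)

/-- Rank one along a given sequence `(Fₙ)`: there are Rokhlin towers `(Yₙ, fₙ, Fₙ)` such
that every measurable set is approximated by unions of levels of the towers. -/
def RankOneAlong (s : H3System) (F : ℕ → Set H3) : Prop :=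
  ∃ (Y : ℕ → Set s.X) (f : ℕ → s.X → H3),
    (∀ n, IsRokhlinTower s (Y n) (f n) (F n)) ∧
    ∀ Bset : Set s.X, MeasurableSet Bset →
      ∃ Hs : ℕ → Set H3, (∀ n, MeasurableSet (Hs n) ∧ Hs n ⊆ F n) ∧
        Tendsto (fun n => s.μ (symmDiff Bset (Y n ∩ (f n) ⁻¹' Hs n))) atTop (𝓝 0)

/-- Rank one: rank one along some Følner sequence. -/
def RankOne (s : H3System) : Prop := ∃ F : ℕ → Set H3, IsFolnerSeq F ∧ RankOneAlong s F

section Joinings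

variable (s : H3System) {ι : Type} (φ : ι → H3)

/-- A 2-fold self-joining of the sub-action `(T_{φ i})_{i∈ι}`: a measure on `X × X`,
invariant under the diagonal action, whose both marginals equal `μ`. -/
def IsSelfJoining2 (ν : Measure (s.X × s.X)) : Prop :=
  IsProbabilityMeasure ν ∧ ν.map Prod.fst = s.μ ∧ ν.map Prod.snd = s.μ ∧
  ∀ i : ι, MeasurePreserving (fun p : s.X × s.X => (s.T (φ i) p.1, s.T (φ i) p.2)) ν ν

/-- An ergodic 2-fold self-joining. -/
def IsErgodicSelfJoining2 (ν : Measure (s.X × s.X)) : Prop :=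
  IsSelfJoining2 s φ ν ∧
  ∀ A : Set (s.X × s.X), MeasurableSet A →
    (∀ i : ι, (fun p : s.X × s.X => (s.T (φ i) p.1, s.T (φ i) p.2)) ⁻¹' A = A) →
    ν A = 0 ∨ ν Aᶜ = 0

/-- The centralizer of the sub-action `(T_{φ i})_{i∈ι}`: invertible measure-preserving
transformations commuting (a.e.) with every `T_{φ i}`. -/
def InCentralizer (R : s.X → s.X) : Prop :=
  Measurable R ∧ MeasurePreserving R s.μ s.μ ∧
  (∃ R' : s.X → s.X, Measurable R' ∧ MeasurePreserving R' s.μ s.μ ∧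
    (∀ᵐ x ∂s.μ, R' (R x) = x) ∧ (∀ᵐ x ∂s.μ, R (R' x) = x)) ∧
  ∀ i : ι, ∀ᵐ x ∂s.μ, R (s.T (φ i) x) = s.T (φ i) (R x)

/-- The off-diagonal (graph) self-joining `μ_R` determined by `R`,
i.e. `μ_R(A × B) = μ(A ∩ R⁻¹B) = μ(RA ∩ B)`. -/
noncomputable def graphJoining (R : s.X → s.X) : Measure (s.X × s.X) :=
  s.μ.map fun x => (x, R x)

/-- 2-fold simplicity of the sub-action `(T_{φ i})_{i∈ι}`: every ergodic 2-fold
self-joining is either off-diagonal over the centralizer or product measure. -/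
def TwoFoldSimple : Prop :=
  ∀ ν : Measure (s.X × s.X), IsErgodicSelfJoining2 s φ ν →
    (∃ R : s.X → s.X, InCentralizer s φ R ∧ ν = graphJoining s R) ∨ ν = s.μ.prod s.μ

/-- An `l`-fold self-joining of the sub-action `(T_{φ i})_{i∈ι}`. -/
def IsSelfJoining (l : ℕ) (ν : Measure (Fin l → s.X)) : Prop :=
  IsProbabilityMeasure ν ∧ (∀ k : Fin l, ν.map (fun x => x k) = s.μ) ∧
  ∀ i : ι, MeasurePreserving (fun (x : Fin l → s.X) k => s.T (φ i) (x k)) ν ν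

/-- Simplicity: 2-fold simple, and for every `l ≥ 2` the only `l`-fold self-joining all of
whose pairwise 2-dimensional projections are `μ × μ` is the product measure. -/
def Simple : Prop :=
  TwoFoldSimple s φ ∧
  ∀ l : ℕ, 2 ≤ l → ∀ ν : Measure (Fin l → s.X), IsSelfJoining s φ l ν →
    (∀ j k : Fin l, j ≠ k → ν.map (fun x => (x j, x k)) = s.μ.prod s.μ) →
    ν = Measure.pi fun _ => s.μ

/-- The centralizer of the sub-action `(T_{φ i})_{i∈ι}` equals `{T_g : g ∈ H₃(ℝ)}`
(modulo null sets). -/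
def CentralizerEq : Prop :=
  ∀ R : s.X → s.X, InCentralizer s φ R ↔ ∃ g : H3, ∀ᵐ x ∂s.μ, R x = s.T g x

/-- Minimal self-joinings (MSJ) of the sub-action `(T_{φ i})_{i∈ι}`: simple, and the
centralizer consists of the transformations of the sub-action itself. -/
def HasMSJ : Prop :=
  Simple s φ ∧ ∀ R : s.X → s.X, InCentralizer s φ R → ∃ i : ι, ∀ᵐ x ∂s.μ, R x = s.T (φ i) x

end Joinings

end BaseDefs

/-- The Poisson distribution with parameter `θ`, as a measure on `ℝ≥0∞`
(giving mass `e^{-θ} θⁿ/n!` to each `n ∈ ℕ`). -/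
noncomputable def poissonENN (θ : ENNReal) : MeasureTheory.Measure ENNReal :=
  MeasureTheory.Measure.sum fun n : ℕ =>
    (ENNReal.ofReal (Real.exp (-θ.toReal) * θ.toReal ^ n / n.factorial)) •
      MeasureTheory.Measure.dirac (n : ENNReal)

/-- `P` is the Poisson suspension `(X̃, μ̃)` of the σ-finite space `(X, μ)`: a probability
measure on the space of measures on `X` (point configurations), under which, for any
finite family of pairwise disjoint sets `Aᵢ` of finite measure, the counting variables
`ω ↦ ω(Aᵢ)` are independent Poisson random variables with parameters `μ(Aᵢ)`. -/
def IsPoissonSuspensionMeasure (s : H3System)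
    (P : MeasureTheory.Measure (MeasureTheory.Measure s.X)) : Prop :=
  MeasureTheory.IsProbabilityMeasure P ∧
  ∀ (k : ℕ) (A : Fin k → Set s.X), (∀ i, MeasurableSet (A i)) →
    Pairwise (Function.onFun Disjoint A) → (∀ i, s.μ (A i) < ⊤) →
    P.map (fun ω (i : Fin k) => ω (A i)) =
      MeasureTheory.Measure.pi fun i => poissonENN (s.μ (A i))

/-- A Gaussian structure on the probability-preserving system `p`: an orthogonal
representation `O` of `H₃(ℝ)` on a nonzero real Hilbert space `H` together with an
equivariant linear isometry `ξ` of `H` into `L²(p.μ)` whose values are centered Gaussian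
random variables with variance `‖v‖²`, generating the full σ-algebra (mod `μ`). A system
admitting such a structure is (isomorphic to) the Gaussian action built from `O`. -/
structure GaussianData (p : H3System) : Type 1 where
  H : Type
  [ng : NormedAddCommGroup H]
  [ip : InnerProductSpace ℝ H]
  nontrivial : ∃ v : H, v ≠ 0
  O : H3 → H ≃ₗᵢ[ℝ] H
  O_mul : ∀ g h v, O (g * h) v = O g (O h v)
  xi : H →ₗᵢ[ℝ] MeasureTheory.Lp ℝ 2 p.μ
  gauss : ∀ v : H, p.μ.map (xi v : p.X → ℝ) =
    ProbabilityTheory.gaussianReal 0 (‖v‖₊ ^ 2)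
  equiv : ∀ (g : H3) (v : H),
    (xi (O g v) : p.X → ℝ) =ᵐ[p.μ] fun x => (xi v : p.X → ℝ) (p.T g⁻¹ x)
  generating : ∀ Aset : Set p.X, MeasurableSet Aset →
    ∃ A' : Set p.X,
      @MeasurableSet p.X
        (⨆ v : H, MeasurableSpace.comap (fun x => (xi v : p.X → ℝ) x) inferInstance) A' ∧
      p.μ (symmDiff Aset A') = 0


section P0a
open Filter Topology Pointwise
open MeasureTheory ProbabilityTheory

lemma image_eq_preimage_inv {Y : Type*} (S : H3 → Y → Y)
    (hS : ∀ g x, S g (S g⁻¹ x) = x) (g : H3) (A : Set Y) : S g '' A = S g⁻¹ ⁻¹' A := by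
  have hS' : ∀ g x, S g⁻¹ (S g x) = x := fun g x => by simpa using hS g⁻¹ x
  ext x
  constructor
  · rintro ⟨y, hy, rfl⟩
    simpa [hS'] using hy
  · intro hx
    exact ⟨_, hx, hS g x⟩

/-- Mixing follows from eventual exact independence on an exhausting sequence of σ-algebras. -/
lemma mixing_of_local {Y : Type*} [mY : MeasurableSpace Y] (ν : Measure Y) [IsProbabilityMeasure ν]
    (S : H3 → Y → Y) (hS : ∀ g x, S g (S g⁻¹ x) = x)
    (hmp : ∀ g, MeasurePreserving (S g) ν ν)
    (F : ℕ → MeasurableSpace Y) (hmono : Monotone F) (hF : ∀ n, F n ≤ mY) (hgen : mY ≤ ⨆ n, F n)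
    (hind : ∀ n, ∀ᶠ g in cocompact H3, ∀ A B : Set Y, MeasurableSet[F n] A → MeasurableSet[F n] B →
      ν (S g⁻¹ ⁻¹' A ∩ B) = ν A * ν B) : MixingFam ν S := by
  have hgen' : mY = MeasurableSpace.generateFrom {A | ∃ n, MeasurableSet[F n] A} := by
    apply le_antisymm
    · refine hgen.trans (iSup_le fun n => ?_)
      intro A hA
      exact MeasurableSpace.measurableSet_generateFrom ⟨n, hA⟩
    · apply MeasurableSpace.generateFrom_le
      rintro A ⟨n, hA⟩
      exact hF n A hA
  have hpi : IsPiSystem {A | ∃ n, MeasurableSet[F n] A} := by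
    rintro A ⟨n, hA⟩ B ⟨m, hB⟩ -
    exact ⟨max n m, MeasurableSet.inter (m := F (max n m)) (hmono (le_max_left _ _) _ hA)
      (hmono (le_max_right _ _) _ hB)⟩
  -- real-valued reformulation
  have key : ∀ A B : Set Y, MeasurableSet A → MeasurableSet B →
      Tendsto (fun g : H3 => ν.real (S g⁻¹ ⁻¹' A ∩ B)) (cocompact H3) (𝓝 (ν.real A * ν.real B)) := by
    have hpre : ∀ g A, MeasurableSet A → ν.real (S g ⁻¹' A) = ν.real A := fun g A hA => by
      simp [Measure.real, (hmp g).measure_preimage hA.nullMeasurableSet]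
    -- one variable step, abstractly
    have step : ∀ (f : H3 → Set Y → ℝ) (c : ℝ),
        (∀ g, f g Set.univ = c) → (∀ g A, 0 ≤ f g A) →
        (∀ g A B, MeasurableSet A → MeasurableSet B → Disjoint A B → f g (A ∪ B) = f g A + f g B) →
        (∀ g A, MeasurableSet A → f g A ≤ ν.real A) →
        (∀ A, (∃ n, MeasurableSet[F n] A) →
          Tendsto (fun g => f g A) (cocompact H3) (𝓝 (ν.real A * c))) →
        ∀ A, MeasurableSet A → Tendsto (fun g => f g A) (cocompact H3) (𝓝 (ν.real A * c)) := by
      intro f c hu h0 hadd hle hloc A hA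
      induction A, hA using MeasurableSpace.induction_on_inter hgen' hpi with
      | empty =>
        have : ∀ g, f g ∅ = 0 := fun g => le_antisymm
          ((hle g ∅ MeasurableSet.empty).trans (by simp)) (h0 _ _)
        simpa [this] using tendsto_const_nhds
      | basic t ht => exact hloc t ht
      | compl t ht ih =>
        have h1 : ∀ g, f g tᶜ = c - f g t := fun g => by
          have := hadd g t tᶜ ht ht.compl disjoint_compl_right
          rw [Set.union_compl_self, hu] at this
          linarith
        simp_rw [h1, measureReal_compl ht, probReal_univ, sub_mul, one_mul]
        exact tendsto_const_nhds.sub ih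
      | iUnion t hd ht ih =>
        have hfin : ∀ N : ℕ, MeasurableSet (⋃ i ∈ Finset.range N, t i) := fun N =>
          Finset.measurableSet_biUnion _ fun i _ => ht i
        have hsplit : ∀ N : ℕ, (⋃ i, t i) = (⋃ i ∈ Finset.range N, t i) ∪ (⋃ i, t (i + N)) := by
          intro N
          ext x
          simp only [Set.mem_iUnion, Set.mem_union, Finset.mem_range, exists_prop]
          constructor
          · rintro ⟨i, hi⟩
            by_cases h : i < N
            · exact Or.inl ⟨i, h, hi⟩
            · exact Or.inr ⟨i - N, by rwa [Nat.sub_add_cancel (not_lt.mp h)]⟩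
          · rintro (⟨i, _, hi⟩ | ⟨i, hi⟩)
            exacts [⟨i, hi⟩, ⟨_, hi⟩]
        have hdisj : ∀ N : ℕ, Disjoint (⋃ i ∈ Finset.range N, t i) (⋃ i, t (i + N)) := by
          intro N
          simp only [Set.disjoint_iUnion_left, Set.disjoint_iUnion_right, Finset.mem_range]
          intro i j hi
          exact hd (by omega)
        have htail : ∀ N, MeasurableSet (⋃ i, t (i + N)) := fun N =>
          MeasurableSet.iUnion fun i => ht _
        have hpart : ∀ N, Tendsto (fun g => f g (⋃ i ∈ Finset.range N, t i)) (cocompact H3)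
            (𝓝 (ν.real (⋃ i ∈ Finset.range N, t i) * c)) := by
          intro N
          induction N with
          | zero =>
            have : ∀ g, f g ∅ = 0 := fun g => le_antisymm
              ((hle g ∅ MeasurableSet.empty).trans (by simp)) (h0 _ _)
            simpa [this] using tendsto_const_nhds
          | succ N ihN =>
            have e : (⋃ i ∈ Finset.range (N + 1), t i) = (⋃ i ∈ Finset.range N, t i) ∪ t N := by
              simp [Finset.range_add_one, Set.union_comm]
            have hdN : Disjoint (⋃ i ∈ Finset.range N, t i) (t N) := by
              simp only [Set.disjoint_iUnion_left, Finset.mem_range]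
              intro i hi
              exact hd (by omega)
            rw [e, measureReal_union hdN (ht N) (measure_ne_top _ _) (measure_ne_top _ _), add_mul]
            simp_rw [fun g => hadd g _ _ (hfin N) (ht N) hdN]
            exact ihN.add (ih N)
        have hc : |c| ≤ 1 := by
          rcases isEmpty_or_nonempty H3 with h | ⟨⟨g⟩⟩
          · exact (h.false 1).elim
          · rw [← hu g, abs_of_nonneg (h0 _ _)]
            exact (hle g _ MeasurableSet.univ).trans (by simp)
        have htail0 : Tendsto (fun N => ν.real (⋃ i, t (i + N))) atTop (𝓝 0) := by
          have h1 : Tendsto (fun N => ν.real (⋃ i ∈ Finset.range N, t i)) atTop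
              (𝓝 (ν.real (⋃ i, t i))) := by
            have h2 : (⋃ i, t i) = ⋃ N, ⋃ i ∈ Finset.range N, t i := by
              ext x
              simp only [Set.mem_iUnion, Finset.mem_range, exists_prop]
              constructor
              · rintro ⟨i, hi⟩
                exact ⟨i + 1, i, by omega, hi⟩
              · rintro ⟨_, i, _, hi⟩
                exact ⟨i, hi⟩
            rw [h2]
            refine (ENNReal.tendsto_toReal (measure_ne_top _ _)).comp
              (tendsto_measure_iUnion_atTop ?_)
            intro a b hab
            apply Set.biUnion_subset_biUnion_left
            simpa using hab
          have h3 : ∀ N, ν.real (⋃ i, t (i + N)) =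
              ν.real (⋃ i, t i) - ν.real (⋃ i ∈ Finset.range N, t i) := fun N => by
            have := measureReal_union (μ := ν) (hdisj N) (htail N) (measure_ne_top _ _) (measure_ne_top _ _)
            rw [← hsplit N] at this
            linarith
          simp_rw [h3]
          simpa using (tendsto_const_nhds (x := ν.real (⋃ i, t i))).sub h1
        rw [Metric.tendsto_nhds]
        intro ε hε
        obtain ⟨N, hN⟩ := (htail0.eventually (gt_mem_nhds (show (0 : ℝ) < ε / 4 by linarith))).exists
        have hp := (Metric.tendsto_nhds.mp (hpart N)) (ε / 4) (by linarith)
        filter_upwards [hp] with g hg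
        rw [Real.dist_eq] at hg ⊢
        have e1 : f g (⋃ i, t i) = f g (⋃ i ∈ Finset.range N, t i) + f g (⋃ i, t (i + N)) := by
          rw [hsplit N, hadd g _ _ (hfin N) (htail N) (hdisj N)]
        have e2 : ν.real (⋃ i, t i) = ν.real (⋃ i ∈ Finset.range N, t i) + ν.real (⋃ i, t (i + N)) := by
          rw [hsplit N, measureReal_union (hdisj N) (htail N) (measure_ne_top _ _) (measure_ne_top _ _)]
        have e3 := hle g _ (htail N)
        have e4 := h0 g (⋃ i, t (i + N))
        have e5 : |ν.real (⋃ i, t (i + N)) * c| ≤ ε / 4 := by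
          rw [abs_mul, abs_of_nonneg measureReal_nonneg]
          calc _ ≤ ν.real (⋃ i, t (i + N)) * 1 := by gcongr
            _ ≤ _ := by linarith
        rw [e1, e2, add_mul]
        rw [abs_lt] at hg ⊢
        rw [abs_le] at e5
        constructor <;> linarith [hg.1, hg.2, e5.1, e5.2]
    intro A B hA hB
    refine step (fun g A => ν.real (S g⁻¹ ⁻¹' A ∩ B)) (ν.real B) (by simp)
      (fun _ _ => measureReal_nonneg) ?_ ?_ ?_ A hA
    · intro g A₁ A₂ h1 h2 hd
      simp only [Set.preimage_union, Set.union_inter_distrib_right]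
      exact measureReal_union (((hd.preimage _).mono Set.inter_subset_left Set.inter_subset_left))
        (((hmp _).measurable h2).inter hB)
    · intro g A hA
      rw [← hpre g⁻¹ A hA]
      exact measureReal_mono Set.inter_subset_left
    · rintro A ⟨n, hA⟩
      have hA' := hF n A hA
      have := step (fun g B => ν.real (S g⁻¹ ⁻¹' A ∩ B)) (ν.real A) (by simp [hpre _ A hA'])
        (fun _ _ => measureReal_nonneg) ?_ ?_ ?_ B hB
      · simpa [mul_comm] using this
      · intro g B₁ B₂ h1 h2 hd
        simp only [Set.inter_union_distrib_left]
        exact measureReal_union (hd.mono Set.inter_subset_right Set.inter_subset_right)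
          (((hmp _).measurable hA').inter h2)
      · intro g B hB
        exact measureReal_mono Set.inter_subset_right
      · rintro B ⟨m, hB⟩
        refine tendsto_const_nhds.congr' ?_
        filter_upwards [hind (max n m)] with g hg
        have h := hg A B (hmono (le_max_left _ _) _ hA) (hmono (le_max_right _ _) _ hB)
        simp [Measure.real, mul_comm, h]
  intro A B hA hB
  simp_rw [image_eq_preimage_inv S hS]
  have := key A B hA hB
  rw [← ENNReal.tendsto_toReal_iff]
  · simpa [Measure.real] using this
  · intro g; exact measure_ne_top _ _
  · exact ENNReal.mul_ne_top (measure_ne_top _ _) (measure_ne_top _ _)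

end P0a

section P1
open Filter Topology Pointwise
open MeasureTheory ProbabilityTheory

abbrev VV : Type := ℝ × ℝ × ℝ

/-- left translation of the Heisenberg group in coordinates -/
def hAct (g : H3) (p : VV) : VV := (g.a + p.1, g.b + p.2.1, g.c + p.2.2 + g.a * p.2.1)

lemma hAct_one (p : VV) : hAct 1 p = p := by
  simp [hAct]

lemma hAct_mul (g h : H3) (p : VV) : hAct (g * h) p = hAct g (hAct h p) := by
  simp only [hAct, H3.mul_a, H3.mul_b, H3.mul_c, Prod.mk.injEq]
  refine ⟨by ring, by ring, by ring⟩

lemma hAct_inv_act (g : H3) (p : VV) : hAct g⁻¹ (hAct g p) = p := by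
  rw [← hAct_mul]; simp [hAct_one]

lemma hAct_act_inv (g : H3) (p : VV) : hAct g (hAct g⁻¹ p) = p := by
  rw [← hAct_mul]; simp [hAct_one]

lemma measurable_H3_toProd : Measurable H3.toProd := comap_measurable _

lemma measurable_H3_a : Measurable H3.a := measurable_fst.comp measurable_H3_toProd
lemma measurable_H3_b : Measurable H3.b :=
  measurable_fst.comp (measurable_snd.comp measurable_H3_toProd)
lemma measurable_H3_c : Measurable H3.c :=
  measurable_snd.comp (measurable_snd.comp measurable_H3_toProd)

lemma measurable_H3_ofProd : Measurable H3.ofProd := by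
  rw [measurable_comap_iff]
  exact measurable_id

lemma measurable_H3_inv : Measurable (fun g : H3 => g⁻¹) := by
  rw [measurable_comap_iff]
  exact (measurable_H3_a.neg).prodMk ((measurable_H3_b.neg).prodMk
    ((measurable_H3_a.mul measurable_H3_b).sub measurable_H3_c))

lemma measurable_hAct_joint : Measurable fun p : H3 × VV => hAct p.1 p.2 := by
  have ha : Measurable fun p : H3 × VV => p.1.a := measurable_H3_a.comp measurable_fst
  have hb : Measurable fun p : H3 × VV => p.1.b := measurable_H3_b.comp measurable_fst
  have hc : Measurable fun p : H3 × VV => p.1.c := measurable_H3_c.comp measurable_fst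
  have h1 : Measurable fun p : H3 × VV => p.2.1 := by fun_prop
  have h2 : Measurable fun p : H3 × VV => p.2.2.1 := by fun_prop
  have h3 : Measurable fun p : H3 × VV => p.2.2.2 := by fun_prop
  exact (ha.add h1).prodMk ((hb.add h2).prodMk ((hc.add h3).add (ha.mul h2)))

lemma continuous_hAct (g : H3) : Continuous (hAct g) := by
  unfold hAct; fun_prop

lemma measurable_hAct (g : H3) : Measurable (hAct g) := (continuous_hAct g).measurable

lemma mp_hAct (g : H3) : MeasurePreserving (hAct g) (volume : Measure VV) volume := by
  have h1 : MeasurePreserving (fun x : ℝ => g.a + x) volume volume :=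
    measurePreserving_add_left _ _
  have h2 : MeasurePreserving (fun q : ℝ × ℝ => (g.b + q.1, g.c + q.2 + g.a * q.1))
      (volume : Measure (ℝ × ℝ)) volume := by
    refine MeasurePreserving.skew_product (f := fun x : ℝ => g.b + x)
      (g := fun x y => g.c + y + g.a * x) (μa := volume) (μb := volume) (μc := volume)
      (μd := volume) (measurePreserving_add_left _ _) (by fun_prop) ?_
    filter_upwards with x
    have := (measurePreserving_add_left (volume : Measure ℝ) (g.c + g.a * x)).map_eq
    convert this using 2
    ext y; ring
  exact h1.prod h2

/-- boxes -/
def KK (n : ℕ) : Set VV := Metric.closedBall 0 n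

lemma measurableSet_KK (n : ℕ) : MeasurableSet (KK n) := Metric.isClosed_closedBall.measurableSet

lemma mem_KK {n : ℕ} {p : VV} : p ∈ KK n ↔ |p.1| ≤ n ∧ |p.2.1| ≤ n ∧ |p.2.2| ≤ n := by
  simp [KK, Prod.norm_def]

lemma volume_KK (n : ℕ) : volume (KK n) < ⊤ := measure_closedBall_lt_top

lemma KK_mono : Monotone KK := fun _ _ h => Metric.closedBall_subset_closedBall (by exact_mod_cast h)

lemma iUnion_KK : ⋃ n, KK n = Set.univ := by
  ext p
  simp only [KK, Set.mem_iUnion, Set.mem_univ, iff_true, mem_closedBall_zero_iff]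
  exact exists_nat_ge _

lemma eventually_disjoint_KK (n : ℕ) :
    ∀ᶠ g in cocompact H3, ∀ p ∈ KK n, hAct g p ∉ KK n := by
  have hc : Continuous H3.ofProd := by
    rw [continuous_induced_rng]; exact continuous_id
  have hcomp : IsCompact (H3.ofProd '' (Metric.closedBall (0 : VV) (2 * n + 2 * n * n))) :=
    (isCompact_closedBall _ _).image hc
  filter_upwards [hcomp.compl_mem_cocompact] with g hg p hp hq
  apply hg
  refine ⟨H3.toProd g, ?_, rfl⟩
  rw [mem_KK] at hp hq
  obtain ⟨p1, p2, p3⟩ := hp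
  obtain ⟨q1, q2, q3⟩ := hq
  simp only [hAct] at q1 q2 q3
  have hn : (0 : ℝ) ≤ n := Nat.cast_nonneg n
  have a1 : |g.a| ≤ 2 * n := by
    rw [abs_le] at *; constructor <;> linarith
  have b1 : |g.b| ≤ 2 * n := by
    rw [abs_le] at *; constructor <;> linarith
  have ab : |g.a * p.2.1| ≤ 2 * n * n := by
    rw [abs_mul]; gcongr
  have c1 : |g.c| ≤ 2 * n + 2 * n * n := by
    rw [abs_le] at *; constructor <;> linarith
  have : 0 ≤ 2 * (n:ℝ) * n := by positivity
  rw [mem_closedBall_zero_iff]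
  simp only [H3.toProd, Prod.norm_def, Real.norm_eq_abs, sup_le_iff]
  exact ⟨by linarith, by linarith, c1⟩

end P1

section P2a
open Filter Topology Pointwise
open MeasureTheory ProbabilityTheory
open scoped ENNReal BoundedContinuousFunction

/-- `exp (-x)` on extended nonnegative reals -/
noncomputable def ee (x : ℝ≥0∞) : ℝ≥0∞ := (EReal.exp (x : EReal))⁻¹

lemma one_le_exp_coe (x : ℝ≥0∞) : 1 ≤ EReal.exp (x : EReal) := by
  rw [EReal.one_le_exp_iff]; exact EReal.coe_ennreal_nonneg x

lemma ee_zero : ee 0 = 1 := by simp [ee]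

lemma ee_add (x y : ℝ≥0∞) : ee (x + y) = ee x * ee y := by
  have hx := one_le_exp_coe x
  have hy := one_le_exp_coe y
  unfold ee
  rw [EReal.coe_ennreal_add, EReal.exp_add, ENNReal.mul_inv]
  · left; exact (zero_lt_one.trans_le hx).ne'
  · right; exact (zero_lt_one.trans_le hy).ne'

lemma ee_le_one (x : ℝ≥0∞) : ee x ≤ 1 := ENNReal.inv_le_one.2 (one_le_exp_coe x)

lemma ee_ne_top (x : ℝ≥0∞) : ee x ≠ ⊤ := ((ee_le_one x).trans_lt ENNReal.one_lt_top).ne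

lemma continuous_ee : Continuous ee :=
  continuous_inv.comp (ENNReal.continuous_exp.comp continuous_coe_ennreal_ereal)

lemma measurable_ee : Measurable ee := continuous_ee.measurable

lemma ee_inj : Function.Injective ee := fun x y h => by
  have := EReal.exp_strictMono.injective (inv_injective h)
  exact_mod_cast this

lemma ee_ofReal {x : ℝ} (hx : 0 ≤ x) : ee (ENNReal.ofReal x) = ENNReal.ofReal (Real.exp (-x)) := by
  unfold ee
  rw [EReal.coe_ennreal_ofReal, max_eq_left hx, EReal.exp_coe, Real.exp_neg,
    ENNReal.ofReal_inv_of_pos (Real.exp_pos _)]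

lemma ee_eq {x : ℝ≥0∞} (hx : x ≠ ⊤) : ee x = ENNReal.ofReal (Real.exp (-x.toReal)) := by
  rw [← ee_ofReal ENNReal.toReal_nonneg, ENNReal.ofReal_toReal hx]

lemma ee_sum {ι : Type*} (s : Finset ι) (f : ι → ℝ≥0∞) : ee (∑ i ∈ s, f i) = ∏ i ∈ s, ee (f i) := by
  classical
  induction s using Finset.induction_on with
  | empty => simp [ee_zero]
  | insert i s hi ih => rw [Finset.sum_insert hi, Finset.prod_insert hi, ee_add, ih]

/-- test functions -/
noncomputable def uu {ι : Type*} [Fintype ι] (k : ι → ℕ) : (ι → ℝ≥0∞) →ᵇ ℝ :=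
  BoundedContinuousFunction.ofNormedAddCommGroup
    (fun x => (ee (∑ i, (k i : ℝ≥0∞) * x i)).toReal)
    (by
      refine ENNReal.continuousOn_toReal.comp_continuous ?_ fun x => ee_ne_top _
      refine continuous_ee.comp (continuous_finsetSum _ fun i _ => ?_)
      exact (ENNReal.continuous_const_mul (ENNReal.natCast_ne_top _)).comp (continuous_apply i))
    1 (fun x => by
      rw [Real.norm_of_nonneg ENNReal.toReal_nonneg]
      exact ENNReal.toReal_le_of_le_ofReal zero_le_one (by simpa using ee_le_one _))

lemma uu_apply {ι : Type*} [Fintype ι] (k : ι → ℕ) (x : ι → ℝ≥0∞) :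
    uu k x = (ee (∑ i, (k i : ℝ≥0∞) * x i)).toReal := rfl

lemma uu_mul {ι : Type*} [Fintype ι] (k l : ι → ℕ) : uu k * uu l = uu (k + l) := by
  ext x
  simp only [BoundedContinuousFunction.mul_apply, uu_apply, Pi.add_apply, Nat.cast_add, add_mul,
    Finset.sum_add_distrib, ee_add, ENNReal.toReal_mul]

theorem ext_of_laplace_fin {ι : Type*} [Fintype ι] (P P' : Measure (ι → ℝ≥0∞))
    [IsFiniteMeasure P] [IsFiniteMeasure P']
    (h : ∀ k : ι → ℕ, ∫⁻ x, ee (∑ i, (k i : ℝ≥0∞) * x i) ∂P = ∫⁻ x, ee (∑ i, (k i : ℝ≥0∞) * x i) ∂P') :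
    P = P' := by
  classical
  let A : StarSubalgebra ℝ ((ι → ℝ≥0∞) →ᵇ ℝ) :=
    { Algebra.adjoin ℝ (Set.range (uu (ι := ι))) with
      star_mem' := fun {a} ha => by
        have : star a = a := by ext x; simp
        rw [this]; exact ha }
  have hint : ∀ k : ι → ℕ, ∫ x, uu k x ∂P = ∫ x, uu k x ∂P' := by
    intro k
    have hm : Measurable fun x : ι → ℝ≥0∞ => ee (∑ i, (k i : ℝ≥0∞) * x i) :=
      measurable_ee.comp (by fun_prop)
    simp only [uu_apply]
    rw [integral_toReal hm.aemeasurable (by filter_upwards with x using (ee_ne_top _).lt_top),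
      integral_toReal hm.aemeasurable (by filter_upwards with x using (ee_ne_top _).lt_top), h k]
  refine ext_of_forall_mem_subalgebra_integral_eq_of_polish (𝕜 := ℝ) (A := A) ?_ ?_
  · intro x y hxy
    obtain ⟨i, hi⟩ := Function.ne_iff.1 hxy
    refine ⟨_, ⟨_, ⟨uu (Pi.single i 1), Algebra.subset_adjoin ⟨_, rfl⟩, rfl⟩, rfl⟩, ?_⟩
    have key : ∀ z : ι → ℝ≥0∞, uu (Pi.single i 1) z = (ee (z i)).toReal := by
      intro z
      rw [uu_apply, Finset.sum_eq_single i]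
      · simp
      · intro j _ hj; simp [hj]
      · simp
    change uu (Pi.single i 1) x ≠ uu (Pi.single i 1) y
    rw [key, key]
    intro hh
    rw [ENNReal.toReal_eq_toReal_iff' (ee_ne_top _) (ee_ne_top _)] at hh
    exact hi (ee_inj hh)
  · intro g hg
    have hg' : g ∈ Submodule.span ℝ (Submonoid.closure (Set.range (uu (ι := ι))) : Set _) := by
      rw [← Algebra.adjoin_eq_span]; exact hg
    clear hg
    induction hg' using Submodule.span_induction with
    | mem g hg =>
      have : ∃ k, g = uu k := by
        induction hg using Submonoid.closure_induction with
        | mem g hg => obtain ⟨k, rfl⟩ := hg; exact ⟨k, rfl⟩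
        | one => refine ⟨0, ?_⟩; ext x; simp [uu_apply, ee_zero]
        | mul a b _ _ ha hb =>
          obtain ⟨k, rfl⟩ := ha
          obtain ⟨l, rfl⟩ := hb
          exact ⟨_, uu_mul _ _⟩
      obtain ⟨k, rfl⟩ := this
      exact hint k
    | zero => simp
    | add a b ha hb iha ihb =>
      have e1 : ∀ Q : Measure (ι → ℝ≥0∞), IsFiniteMeasure Q → ∫ x, (a + b) x ∂Q = ∫ x, a x ∂Q + ∫ x, b x ∂Q := by
        intro Q hQ
        exact integral_add (a.integrable Q) (b.integrable Q)
      rw [e1 P inferInstance, e1 P' inferInstance, iha, ihb]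
    | smul c a ha iha =>
      simp only [BoundedContinuousFunction.smul_apply, integral_smul]
      rw [iha]

theorem ext_of_laplace {α : Type*} [MeasurableSpace α] (P P' : Measure (Measure α))
    [IsFiniteMeasure P] [IsFiniteMeasure P']
    (h : ∀ f : α → ℝ≥0∞, Measurable f → ∫⁻ ω, ee (∫⁻ x, f x ∂ω) ∂P = ∫⁻ ω, ee (∫⁻ x, f x ∂ω) ∂P') :
    P = P' := by
  classical
  let m : {s : Set α // MeasurableSet s} → MeasurableSpace (Measure α) :=
    fun s => MeasurableSpace.comap (fun ω : Measure α => ω s.1) inferInstance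
  have hgen : (inferInstance : MeasurableSpace (Measure α)) = MeasurableSpace.generateFrom
      (piiUnionInter (fun n => {s | MeasurableSet[m n] s}) Set.univ) := by
    refine Eq.trans ?_ (generateFrom_piiUnionInter_measurableSet m Set.univ).symm
    change Measure.instMeasurableSpace = _
    unfold Measure.instMeasurableSpace
    simp only [m, Set.mem_univ, iSup_pos, iSup_subtype]
    rfl
  have hfd : ∀ t : Finset {s : Set α // MeasurableSet s},
      P.map (fun ω (i : t) => ω i.1.1) = P'.map (fun ω (i : t) => ω i.1.1) := by
    intro t
    have hm : Measurable (fun (ω : Measure α) (i : t) => ω i.1.1) :=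
      measurable_pi_lambda _ fun i => Measure.measurable_coe i.1.2
    refine ext_of_laplace_fin _ _ fun k => ?_
    have hm2 : Measurable fun x : t → ℝ≥0∞ => ee (∑ i, (k i : ℝ≥0∞) * x i) :=
      measurable_ee.comp (by fun_prop)
    rw [lintegral_map hm2 hm, lintegral_map hm2 hm]
    have key : ∀ ω : Measure α, (∑ i : t, (k i : ℝ≥0∞) * ω i.1.1) =
        ∫⁻ x, ∑ i : t, (k i : ℝ≥0∞) * (i.1.1.indicator 1 x) ∂ω := by
      intro ω
      rw [lintegral_finsetSum]
      · refine Finset.sum_congr rfl fun i _ => ?_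
        rw [lintegral_const_mul _ (measurable_one.indicator i.1.2), lintegral_indicator_one i.1.2]
      · intro i _
        exact (measurable_one.indicator i.1.2).const_mul _
    simp only [key]
    apply h
    exact Finset.measurable_fun_sum _ fun i _ => (measurable_one.indicator i.1.2).const_mul _
  refine ext_of_generate_finite _ hgen (isPiSystem_piiUnionInter _ (fun x => ?_) _) ?_ ?_
  · exact (m x).isPiSystem_measurableSet
  · rintro s ⟨t, -, f, hf, rfl⟩
    have : ∀ x : t, ∃ B : Set ℝ≥0∞, MeasurableSet B ∧ (fun ω : Measure α => ω x.1.1) ⁻¹' B = f x.1 :=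
      fun x => hf x.1 x.2
    choose B hB hBf using this
    have hs : (⋂ x ∈ t, f x) = (fun (ω : Measure α) (i : t) => ω i.1.1) ⁻¹' (Set.univ.pi B) := by
      ext ω
      simp only [Set.mem_iInter, Set.mem_preimage, Set.mem_pi, Set.mem_univ, forall_true_left]
      constructor
      · intro hω i
        have := hω i.1 i.2
        rw [← hBf i] at this
        exact this
      · intro hω x hx
        rw [← hBf ⟨x, hx⟩]
        exact hω ⟨x, hx⟩
    have hm : Measurable (fun (ω : Measure α) (i : t) => ω i.1.1) :=
      measurable_pi_lambda _ fun i => Measure.measurable_coe i.1.2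
    rw [hs, ← Measure.map_apply hm (MeasurableSet.univ_pi hB), hfd,
      Measure.map_apply hm (MeasurableSet.univ_pi hB)]
  · have := h 0 measurable_zero
    simpa [ee_zero] using this

end P2a

section P3a
open Filter Topology Pointwise
open MeasureTheory ProbabilityTheory
open scoped ENNReal BoundedContinuousFunction

lemma tsum_poisson_weights (m z : ℝ≥0∞) (hm : m ≠ ⊤) (hz : z ≤ 1) :
    ∑' N : ℕ, ENNReal.ofReal (Real.exp (-m.toReal) * m.toReal ^ N / N.factorial) * z ^ N
      = ee (m * (1 - z)) := by
  have hzt : z ≠ ⊤ := (hz.trans_lt ENNReal.one_lt_top).ne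
  have h1 : ∀ N : ℕ, ENNReal.ofReal (Real.exp (-m.toReal) * m.toReal ^ N / N.factorial) * z ^ N
      = ENNReal.ofReal (Real.exp (-m.toReal) * ((m.toReal * z.toReal) ^ N / N.factorial)) := by
    intro N
    conv_lhs => rw [← ENNReal.ofReal_toReal hzt, ← ENNReal.ofReal_pow ENNReal.toReal_nonneg,
      ← ENNReal.ofReal_mul (by positivity)]
    congr 1
    rw [mul_pow]; ring
  have h2 : HasSum (fun N : ℕ => Real.exp (-m.toReal) * ((m.toReal * z.toReal) ^ N / N.factorial))
      (Real.exp (-m.toReal) * Real.exp (m.toReal * z.toReal)) := by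
    refine HasSum.mul_left _ ?_
    rw [Real.exp_eq_exp_ℝ]
    exact NormedSpace.expSeries_div_hasSum_exp (m.toReal * z.toReal)
  simp only [h1]
  rw [← ENNReal.ofReal_tsum_of_nonneg (fun N => by positivity) h2.summable, h2.tsum_eq,
    ee_eq (ENNReal.mul_ne_top hm (ENNReal.sub_ne_top ENNReal.one_ne_top)), ← Real.exp_add,
    ENNReal.toReal_mul, ENNReal.toReal_sub_of_le hz ENNReal.one_ne_top]
  congr 2
  simp; ring

lemma tsum_poisson_weights_one (m : ℝ≥0∞) (hm : m ≠ ⊤) :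
    ∑' N : ℕ, ENNReal.ofReal (Real.exp (-m.toReal) * m.toReal ^ N / N.factorial) = 1 := by
  have := tsum_poisson_weights m 1 hm le_rfl
  simpa [ee_zero] using this

lemma isProb_poissonENN (m : ℝ≥0∞) (hm : m ≠ ⊤) : IsProbabilityMeasure (poissonENN m) := by
  constructor
  simp only [poissonENN, Measure.sum_apply _ MeasurableSet.univ, Measure.smul_apply, smul_eq_mul,
    measure_univ, mul_one]
  exact tsum_poisson_weights_one m hm

lemma ee_natCast_mul (n : ℕ) (x : ℝ≥0∞) : ee (n * x) = ee x ^ n := by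
  induction n with
  | zero => simp [ee_zero]
  | succ n ih => rw [Nat.cast_succ, add_mul, one_mul, ee_add, ih, pow_succ]

lemma laplace_poissonENN (m : ℝ≥0∞) (hm : m ≠ ⊤) (t : ℝ≥0∞) :
    ∫⁻ x, ee (t * x) ∂(poissonENN m) = ee (m * (1 - ee t)) := by
  rw [← tsum_poisson_weights m _ hm (ee_le_one t)]
  simp only [poissonENN, lintegral_sum_measure, lintegral_smul_measure, smul_eq_mul]
  refine tsum_congr fun N => ?_
  rw [lintegral_dirac, mul_comm t, ee_natCast_mul]

variable {α : Type*} [MeasurableSpace α]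

lemma measurable_sum_dirac (N : ℕ) :
    Measurable (fun x : Fin N → α => ∑ i, Measure.dirac (x i)) := by
  refine Measure.measurable_of_measurable_coe _ fun s hs => ?_
  simp only [Measure.coe_finsetSum, Finset.sum_apply]
  refine Finset.measurable_fun_sum _ fun i _ => ?_
  exact (Measure.measurable_coe hs).comp (Measure.measurable_dirac.comp (measurable_pi_apply i))

/-- Poisson process with finite intensity `m • ρ` -/
noncomputable def poi (m : ℝ≥0∞) (ρ : Measure α) : Measure (Measure α) :=
  Measure.sum fun N : ℕ => ENNReal.ofReal (Real.exp (-m.toReal) * m.toReal ^ N / N.factorial) •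
    (Measure.pi (fun _ : Fin N => ρ)).map (fun x => ∑ i, Measure.dirac (x i))

lemma isProb_poi (m : ℝ≥0∞) (hm : m ≠ ⊤) (ρ : Measure α) [IsProbabilityMeasure ρ] :
    IsProbabilityMeasure (poi m ρ) := by
  constructor
  simp only [poi, Measure.sum_apply _ MeasurableSet.univ, Measure.smul_apply, smul_eq_mul]
  have : ∀ N : ℕ, (Measure.pi (fun _ : Fin N => ρ)).map
      (fun x => ∑ i, Measure.dirac (x i)) Set.univ = 1 := by
    intro N
    rw [Measure.map_apply (measurable_sum_dirac N) MeasurableSet.univ]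
    simp
  simp only [this, mul_one]
  exact tsum_poisson_weights_one m hm

lemma measurable_ee_lintegral {f : α → ℝ≥0∞} (hf : Measurable f) :
    Measurable fun ω : Measure α => ee (∫⁻ x, f x ∂ω) :=
  measurable_ee.comp (Measure.measurable_lintegral hf)

lemma laplace_poi (m : ℝ≥0∞) (hm : m ≠ ⊤) (ρ : Measure α) [IsProbabilityMeasure ρ]
    {f : α → ℝ≥0∞} (hf : Measurable f) :
    ∫⁻ ω, ee (∫⁻ x, f x ∂ω) ∂(poi m ρ) = ee (∫⁻ x, (1 - ee (f x)) ∂(m • ρ)) := by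
  have hef : Measurable fun x => ee (f x) := measurable_ee.comp hf
  have hle : ∫⁻ x, ee (f x) ∂ρ ≤ 1 := by
    calc ∫⁻ x, ee (f x) ∂ρ ≤ ∫⁻ x, 1 ∂ρ := lintegral_mono fun x => ee_le_one _
      _ = 1 := by simp
  rw [lintegral_smul_measure, smul_eq_mul, lintegral_sub hef (hle.trans_lt ENNReal.one_lt_top).ne
    (by filter_upwards with x using ee_le_one _)]
  simp only [lintegral_const, measure_univ, mul_one]
  rw [← tsum_poisson_weights m _ hm hle]
  simp only [poi, lintegral_sum_measure, lintegral_smul_measure, smul_eq_mul]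
  refine tsum_congr fun N => ?_
  congr 1
  rw [lintegral_map (measurable_ee_lintegral hf) (measurable_sum_dirac N)]
  have h1 : ∀ x : Fin N → α, ee (∫⁻ y, f y ∂(∑ i, Measure.dirac (x i))) = ∏ i, ee (f (x i)) := by
    intro x
    rw [lintegral_finsetSum_measure, ee_sum]
    simp only [lintegral_dirac' _ hf]
  simp only [h1]
  have hind : iIndepFun (fun (i : Fin N) (x : Fin N → α) => ee (f (x i)))
      (Measure.pi (fun _ : Fin N => ρ)) :=
    iIndepFun_pi (X := fun (i : Fin N) (y : α) => ee (f y)) (fun i => hef.aemeasurable)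
  rw [lintegral_prod_eq_prod_lintegral_of_indepFun Finset.univ
    (fun (i : Fin N) (x : Fin N → α) => ee (f (x i))) hind
    (fun i => hef.comp (measurable_pi_apply i))]
  have : ∀ i : Fin N, ∫⁻ x : Fin N → α, ee (f (x i)) ∂(Measure.pi (fun _ : Fin N => ρ)) =
      ∫⁻ y, ee (f y) ∂ρ := by
    intro i
    have := (measurePreserving_eval (fun _ : Fin N => ρ) i).lintegral_comp hef
    exact this
  simp [this]

theorem exists_poisson [Nonempty α] (μ : Measure α) [SFinite μ] :
    ∃ P : Measure (Measure α), IsProbabilityMeasure P ∧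
      ∀ f : α → ℝ≥0∞, Measurable f →
        ∫⁻ ω, ee (∫⁻ x, f x ∂ω) ∂P = ee (∫⁻ x, (1 - ee (f x)) ∂μ) := by
  have hdec : ∀ n, ∃ ρ : Measure α, IsProbabilityMeasure ρ ∧
      sfiniteSeq μ n = (sfiniteSeq μ n Set.univ) • ρ := by
    intro n
    by_cases h0 : sfiniteSeq μ n = 0
    · obtain ⟨x⟩ := ‹Nonempty α›
      exact ⟨Measure.dirac x, inferInstance, by simp [h0]⟩
    · have h1 : sfiniteSeq μ n Set.univ ≠ 0 := by simpa using h0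
      refine ⟨(sfiniteSeq μ n Set.univ)⁻¹ • sfiniteSeq μ n, ⟨?_⟩, ?_⟩
      · simp [ENNReal.inv_mul_cancel h1 (measure_ne_top _ _)]
      · rw [smul_smul, ENNReal.mul_inv_cancel h1 (measure_ne_top _ _), one_smul]
  choose ρ hρ hdec using hdec
  set m : ℕ → ℝ≥0∞ := fun n => sfiniteSeq μ n Set.univ with hmdef
  have hm : ∀ n, m n ≠ ⊤ := fun n => measure_ne_top _ _
  have hp : ∀ n, IsProbabilityMeasure (poi (m n) (ρ n)) := fun n => isProb_poi _ (hm n) _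
  set Q := Measure.infinitePi (fun n => poi (m n) (ρ n)) with hQ
  have hmeas : Measurable (fun ω : ℕ → Measure α => Measure.sum ω) := by
    refine Measure.measurable_of_measurable_coe _ fun s hs => ?_
    simp only [Measure.sum_apply _ hs]
    exact Measurable.ennreal_tsum fun n => (Measure.measurable_coe hs).comp (measurable_pi_apply n)
  refine ⟨Q.map (fun ω => Measure.sum ω), Measure.isProbabilityMeasure_map hmeas.aemeasurable, ?_⟩
  intro f hf
  rw [lintegral_map (measurable_ee_lintegral hf) hmeas]
  simp only [lintegral_sum_measure]
  have hmf := measurable_ee_lintegral hf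
  have hprod : ∀ N : ℕ, ∫⁻ ω, ee (∑ n ∈ Finset.range N, ∫⁻ x, f x ∂(ω n)) ∂Q =
      ee (∑ n ∈ Finset.range N, ∫⁻ x, (1 - ee (f x)) ∂(sfiniteSeq μ n)) := by
    intro N
    simp only [ee_sum]
    rw [lintegral_prod_eq_prod_lintegral_of_indepFun (Finset.range N)
      (fun n (ω : ℕ → Measure α) => ee (∫⁻ x, f x ∂(ω n)))
      (iIndepFun_infinitePi (P := fun n => poi (m n) (ρ n))
        (X := fun (n : ℕ) (ω : Measure α) => ee (∫⁻ x, f x ∂ω)) (fun n => hmf))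
      (fun n => hmf.comp (measurable_pi_apply n))]
    refine Finset.prod_congr rfl fun n _ => ?_
    rw [hdec n, ← laplace_poi (m n) (hm n) (ρ n) hf]
    have := (measurePreserving_eval_infinitePi (fun n => poi (m n) (ρ n)) n).lintegral_comp hmf
    exact this
  have t1 : Tendsto (fun N : ℕ => ee (∑ n ∈ Finset.range N, ∫⁻ x, (1 - ee (f x)) ∂(sfiniteSeq μ n)))
      atTop (𝓝 (ee (∫⁻ x, (1 - ee (f x)) ∂μ))) := by
    refine (continuous_ee.tendsto _).comp ?_
    have e1 : ∫⁻ x, (1 - ee (f x)) ∂μ = ∑' n, ∫⁻ x, (1 - ee (f x)) ∂(sfiniteSeq μ n) := by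
      rw [← lintegral_sum_measure, sum_sfiniteSeq]
    rw [e1]
    exact ENNReal.tendsto_nat_tsum _
  have t2 : Tendsto (fun N : ℕ => ∫⁻ ω, ee (∑ n ∈ Finset.range N, ∫⁻ x, f x ∂(ω n)) ∂Q) atTop
      (𝓝 (∫⁻ ω, ee (∑' n, ∫⁻ x, f x ∂(ω n)) ∂Q)) := by
    refine tendsto_lintegral_of_dominated_convergence (fun _ => 1) ?_ ?_ ?_ ?_
    · intro N
      exact measurable_ee.comp (Finset.measurable_fun_sum _ fun n _ =>
        (Measure.measurable_lintegral hf).comp (measurable_pi_apply n))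
    · intro N; filter_upwards with ω using ee_le_one _
    · simp
    · filter_upwards with ω
      exact (continuous_ee.tendsto _).comp (ENNReal.tendsto_nat_tsum _)
  simp only [hprod] at t2
  exact tendsto_nhds_unique t2 t1

end P3a

section P4a
open Filter Topology Pointwise
open MeasureTheory ProbabilityTheory
open scoped ENNReal BoundedContinuousFunction

variable {α : Type*} [MeasurableSpace α]

/-- Laplace functional of the Poisson process -/
def IsPois (μ : Measure α) (P : Measure (Measure α)) : Prop :=
  ∀ f : α → ℝ≥0∞, Measurable f →
        ∫⁻ ω, ee (∫⁻ x, f x ∂ω) ∂P = ee (∫⁻ x, (1 - ee (f x)) ∂μ)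

lemma IsPois.fdd {μ : Measure α} {P : Measure (Measure α)} [IsProbabilityMeasure P] (h : IsPois μ P)
    {k : ℕ} (A : Fin k → Set α) (hA : ∀ i, MeasurableSet (A i)) (hd : Pairwise fun i j => Disjoint (A i) (A j))
    (hfin : ∀ i, μ (A i) ≠ ⊤) :
    P.map (fun ω i => ω (A i)) = Measure.pi fun i => poissonENN (μ (A i)) := by
  have hp : ∀ i, IsProbabilityMeasure (poissonENN (μ (A i))) := fun i => isProb_poissonENN _ (hfin i)
  have hm : Measurable (fun (ω : Measure α) (i : Fin k) => ω (A i)) :=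
    measurable_pi_lambda _ fun i => Measure.measurable_coe (hA i)
  refine ext_of_laplace_fin _ _ fun t => ?_
  have hm2 : Measurable fun x : Fin k → ℝ≥0∞ => ee (∑ i, (t i : ℝ≥0∞) * x i) :=
    measurable_ee.comp (by fun_prop)
  rw [lintegral_map hm2 hm]
  have key : ∀ ω : Measure α, (∑ i, (t i : ℝ≥0∞) * ω (A i)) =
      ∫⁻ x, ∑ i, (t i : ℝ≥0∞) * ((A i).indicator 1 x) ∂ω := by
    intro ω
    rw [lintegral_finsetSum]
    · refine Finset.sum_congr rfl fun i _ => ?_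
      rw [lintegral_const_mul _ (measurable_one.indicator (hA i)), lintegral_indicator_one (hA i)]
    · intro i _
      exact (measurable_one.indicator (hA i)).const_mul _
  simp only [key]
  rw [h _ (Finset.measurable_fun_sum _ fun i _ => (measurable_one.indicator (hA i)).const_mul _)]
  have h1 : ∀ x, 1 - ee (∑ i, (t i : ℝ≥0∞) * ((A i).indicator 1 x)) =
      ∑ i, (1 - ee (t i)) * (A i).indicator 1 x := by
    intro x
    by_cases hx : ∃ i, x ∈ A i
    · obtain ⟨i, hi⟩ := hx
      have : ∀ j, j ≠ i → x ∉ A j := fun j hj hxj => Set.disjoint_left.1 (hd hj) hxj hi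
      rw [Finset.sum_eq_single i, Finset.sum_eq_single i]
      · simp [hi]
      · intro j _ hj; simp [this j hj]
      · simp
      · intro j _ hj; simp [this j hj]
      · simp
    · push Not at hx
      simp [hx, ee_zero]
  simp only [h1]
  rw [lintegral_finsetSum _ fun i _ => (measurable_one.indicator (hA i)).const_mul _, ee_sum]
  simp only [ee_sum]
  have hx : ∀ i, Measurable fun x : ℝ≥0∞ => ee (t i * x) := fun i =>
    measurable_ee.comp (measurable_id.const_mul _)
  have hind : iIndepFun (fun (i : Fin k) (x : Fin k → ℝ≥0∞) => ee (t i * x i))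
      (Measure.pi (fun i => poissonENN (μ (A i)))) :=
    iIndepFun_pi (X := fun (i : Fin k) (y : ℝ≥0∞) => ee (t i * y)) (fun i => (hx i).aemeasurable)
  rw [lintegral_prod_eq_prod_lintegral_of_indepFun Finset.univ
    (fun (i : Fin k) (x : Fin k → ℝ≥0∞) => ee (t i * x i)) hind
    (fun i => (hx i).comp (measurable_pi_apply i))]
  refine Finset.prod_congr rfl fun i _ => ?_
  have := (measurePreserving_eval (fun i => poissonENN (μ (A i))) i).lintegral_comp (hx i)
  rw [show ∫⁻ x : Fin k → ℝ≥0∞, ee (t i * x i) ∂(Measure.pi (fun i => poissonENN (μ (A i)))) = _ from this,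
    laplace_poissonENN _ (hfin i), lintegral_const_mul _ (measurable_one.indicator (hA i)),
    lintegral_indicator_one (hA i), mul_comm]

lemma IsPois.mp {μ : Measure α} {P : Measure (Measure α)} [IsProbabilityMeasure P] (h : IsPois μ P)
    {T : α → α} (hT : MeasurePreserving T μ μ) :
    MeasurePreserving (fun ω : Measure α => ω.map T) P P := by
  have hm : Measurable (fun ω : Measure α => ω.map T) := Measure.measurable_map T hT.measurable
  refine ⟨hm, ?_⟩
  have : IsProbabilityMeasure (P.map (fun ω : Measure α => ω.map T)) :=
    Measure.isProbabilityMeasure_map hm.aemeasurable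
  refine ext_of_laplace _ _ fun f hf => ?_
  rw [lintegral_map (measurable_ee_lintegral hf) hm, h f hf]
  simp only [lintegral_map hf hT.measurable]
  rw [h (fun x => f (T x)) (hf.comp hT.measurable)]
  congr 1
  exact hT.lintegral_comp (f := fun x => 1 - ee (f x)) (measurable_const.sub (measurable_ee.comp hf))

lemma measurable_restrict' {K : Set α} (hK : MeasurableSet K) :
    Measurable (fun ω : Measure α => ω.restrict K) := by
  refine Measure.measurable_of_measurable_coe _ fun s hs => ?_
  simp only [Measure.restrict_apply hs]
  exact Measure.measurable_coe (hs.inter hK)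

lemma IsPois.laplace_prod {μ : Measure α} {P : Measure (Measure α)} (h : IsPois μ P)
    {K L : Set α} (hK : MeasurableSet K) (hL : MeasurableSet L) (hd : Disjoint K L)
    {f g : α → ℝ≥0∞} (hf : Measurable f) (hg : Measurable g) :
    ∫⁻ ω, ee (∫⁻ x, f x ∂(ω.restrict K)) * ee (∫⁻ x, g x ∂(ω.restrict L)) ∂P =
    (∫⁻ ω, ee (∫⁻ x, f x ∂(ω.restrict K)) ∂P) * ∫⁻ ω, ee (∫⁻ x, g x ∂(ω.restrict L)) ∂P := by
  simp only [← lintegral_indicator hK, ← lintegral_indicator hL, ← ee_add]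
  have hfK := hf.indicator hK
  have hgL := hg.indicator hL
  simp only [← lintegral_add_left hfK]
  have hm1 : Measurable fun x => 1 - ee (K.indicator f x) :=
    measurable_const.sub (measurable_ee.comp hfK)
  rw [h _ hfK, h _ hgL, show ∫⁻ ω, ee (∫⁻ a, K.indicator f a + L.indicator g a ∂ω) ∂P = _ from h _ (hfK.add hgL), ← ee_add, ← lintegral_add_left hm1]
  congr 2
  ext x
  by_cases hx : x ∈ K
  · have : x ∉ L := Set.disjoint_left.1 hd hx
    simp [hx, this, ee_zero]
  · simp [hx, ee_zero]

lemma IsPois.indep {μ : Measure α} {P : Measure (Measure α)} [IsProbabilityMeasure P] (h : IsPois μ P)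
    {K L : Set α} (hK : MeasurableSet K) (hL : MeasurableSet L) (hd : Disjoint K L)
    {A B : Set (Measure α)} (hA : MeasurableSet A) (hB : MeasurableSet B) :
    P ((fun ω => ω.restrict K) ⁻¹' A ∩ (fun ω => ω.restrict L) ⁻¹' B) =
      P ((fun ω => ω.restrict K) ⁻¹' A) * P ((fun ω => ω.restrict L) ⁻¹' B) := by
  have mK := measurable_restrict' (α := α) hK
  have mL := measurable_restrict' (α := α) hL
  have step1 : ∀ g : α → ℝ≥0∞, Measurable g →
      ∫⁻ ω in (fun ω => ω.restrict K) ⁻¹' A, ee (∫⁻ x, g x ∂(ω.restrict L)) ∂P =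
      (∫⁻ ω, ee (∫⁻ x, g x ∂(ω.restrict L)) ∂P) * P ((fun ω => ω.restrict K) ⁻¹' A) := by
    intro g hg
    set w : Measure α → ℝ≥0∞ := fun ω => ee (∫⁻ x, g x ∂(ω.restrict L)) with hw
    have hwm : Measurable w := (measurable_ee_lintegral hg).comp mL
    have hle : ∫⁻ ω, w ω ∂P ≤ 1 := by
      calc ∫⁻ ω, w ω ∂P ≤ ∫⁻ ω, 1 ∂P := lintegral_mono fun ω => ee_le_one _
        _ = 1 := by simp
    have hlt := hle.trans_lt ENNReal.one_lt_top
    have i1 : IsFiniteMeasure (P.withDensity w) := isFiniteMeasure_withDensity hlt.ne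
    have i2 : IsFiniteMeasure ((∫⁻ ω, w ω ∂P) • P.map (fun ω => ω.restrict K)) :=
      Measure.smul_finite _ hlt.ne
    have : (P.withDensity w).map (fun ω => ω.restrict K) =
        (∫⁻ ω, w ω ∂P) • P.map (fun ω => ω.restrict K) := by
      refine ext_of_laplace _ _ fun f hf => ?_
      rw [lintegral_map (measurable_ee_lintegral hf) mK, lintegral_smul_measure,
        lintegral_map (measurable_ee_lintegral hf) mK,
        show ∫⁻ ω, ee (∫⁻ x, f x ∂(ω.restrict K)) ∂(P.withDensity w) = _ from
          lintegral_withDensity_eq_lintegral_mul _ hwm ((measurable_ee_lintegral hf).comp mK),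
        smul_eq_mul, mul_comm (∫⁻ ω, w ω ∂P), ← h.laplace_prod hK hL hd hf hg]
      refine lintegral_congr fun ω => ?_
      simp [hw, mul_comm]
    have h2 := congrArg (fun ν => ν A) this
    simp only [Measure.map_apply mK hA, Measure.smul_apply, smul_eq_mul,
      withDensity_apply _ (mK hA)] at h2
    exact h2
  set c := P ((fun ω => ω.restrict K) ⁻¹' A) with hc
  have i2 : IsFiniteMeasure (c • P.map (fun ω => ω.restrict L)) :=
    Measure.smul_finite _ (measure_ne_top _ _)
  have : (P.restrict ((fun ω => ω.restrict K) ⁻¹' A)).map (fun ω => ω.restrict L) =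
      c • P.map (fun ω => ω.restrict L) := by
    refine ext_of_laplace _ _ fun f hf => ?_
    rw [lintegral_map (measurable_ee_lintegral hf) mL, lintegral_smul_measure,
      lintegral_map (measurable_ee_lintegral hf) mL, step1 f hf, smul_eq_mul, mul_comm]
  have h2 := congrArg (fun ν => ν B) this
  simp only [Measure.map_apply mL hB, Measure.smul_apply, smul_eq_mul,
    Measure.restrict_apply (mL hB)] at h2
  rw [Set.inter_comm]; exact h2

theorem exists_mixing_poisson :
    ∃ s : H3System, StandardBorelSpace s.X ∧ SigmaFinite s.μ ∧ s.μ Set.univ = ⊤ ∧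
      NoAtoms s.μ ∧
      ∃ P : Measure (Measure s.X), IsPoissonSuspensionMeasure s P ∧
        (∀ g : H3, MeasurePreserving (fun ω : Measure s.X => ω.map (s.T g)) P P) ∧
        MixingFam P fun g ω => ω.map (s.T g) := by
  obtain ⟨P, hP, hPois⟩ := exists_poisson (volume : Measure VV)
  have hPois : IsPois (volume : Measure VV) P := hPois
  refine ⟨⟨VV, volume, hAct, hAct_one, hAct_mul, measurable_hAct_joint, mp_hAct⟩, inferInstanceAs
    (StandardBorelSpace VV), inferInstanceAs (SigmaFinite (volume : Measure VV)), ?_,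
    ?_, P, ⟨hP, ?_⟩, fun g => hPois.mp (mp_hAct g), ?_⟩
  · change (volume : Measure VV) Set.univ = ⊤
    rw [Measure.volume_eq_prod, Measure.volume_eq_prod, ← Set.univ_prod_univ, Measure.prod_prod,
      ← Set.univ_prod_univ, Measure.prod_prod]
    simp
  · change NullSingletonClass (volume : Measure VV)
    constructor
    intro x
    obtain ⟨a, b, c⟩ := x
    rw [Measure.volume_eq_prod, ← Set.singleton_prod_singleton, Measure.prod_prod]
    simp
  · intro k A hA hd hfin
    exact hPois.fdd A hA hd fun i => (hfin i).ne
  · have hmp : ∀ g, MeasurePreserving (fun ω : Measure VV => ω.map (hAct g)) P P :=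
      fun g => hPois.mp (mp_hAct g)
    refine mixing_of_local P (fun g (ω : Measure VV) => ω.map (hAct g)) ?_ hmp
      (fun n => MeasurableSpace.comap (fun ω : Measure VV => ω.restrict (KK n)) inferInstance) ?_ ?_ ?_ ?_
    · intro g ω
      rw [Measure.map_map (measurable_hAct g) (measurable_hAct g⁻¹)]
      have : hAct g ∘ hAct g⁻¹ = id := funext fun x => hAct_act_inv g x
      rw [this, Measure.map_id]
    · intro n m hnm
      have : (fun ω : Measure VV => ω.restrict (KK n)) =
          (fun ω : Measure VV => ω.restrict (KK n)) ∘ (fun ω : Measure VV => ω.restrict (KK m)) := by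
        funext ω
        simp only [Function.comp]
        rw [Measure.restrict_restrict (measurableSet_KK n), Set.inter_eq_left.2 (KK_mono hnm)]
      simp only
      rw [this, ← MeasurableSpace.comap_comp]
      exact MeasurableSpace.comap_mono (measurable_restrict' (measurableSet_KK n)).comap_le
    · intro n
      exact (measurable_restrict' (measurableSet_KK n)).comap_le
    · refine iSup₂_le fun B hB => ?_
      rw [← measurable_iff_comap_le]
      have : (fun ω : Measure VV => ω B) = fun ω => ⨆ n, (ω.restrict (KK n)) B := by
        funext ω
        simp only [Measure.restrict_apply hB]
        rw [← (Monotone.measure_iUnion (μ := ω) (s := fun n => B ∩ KK n) fun n m h =>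
          Set.inter_subset_inter_right _ (KK_mono h)), ← Set.inter_iUnion, iUnion_KK, Set.inter_univ]
      rw [this]
      refine @Measurable.iSup _ _ _ _ _ _ (_) _ _ _ _ _ fun n => ?_
      refine Measurable.mono (ma := MeasurableSpace.comap (fun ω : Measure VV => ω.restrict (KK n)) inferInstance) ?_ (le_iSup (fun n => MeasurableSpace.comap (fun ω : Measure VV => ω.restrict (KK n)) inferInstance) n) le_rfl
      exact (Measure.measurable_coe hB).comp (comap_measurable _)
    · intro n
      filter_upwards [eventually_disjoint_KK n] with g hg A B hA hB
      rw [← (hmp g⁻¹).measure_preimage ((measurable_restrict' (measurableSet_KK n)).comap_le A hA).nullMeasurableSet]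
      obtain ⟨A, hA, rfl⟩ := hA
      obtain ⟨B, hB, rfl⟩ := hB
      have hKm := measurable_hAct g⁻¹ (measurableSet_KK n)
      have e : (fun ω : Measure VV => ω.map (hAct g⁻¹)) ⁻¹' ((fun ω : Measure VV => ω.restrict (KK n)) ⁻¹' A) =
          (fun ω : Measure VV => ω.restrict (hAct g⁻¹ ⁻¹' KK n)) ⁻¹' ((fun ω : Measure VV => ω.map (hAct g⁻¹)) ⁻¹' A) := by
        ext ω
        simp only [Set.mem_preimage]
        rw [Measure.restrict_map (measurable_hAct g⁻¹) (measurableSet_KK n)]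
      rw [e]
      refine hPois.indep hKm (measurableSet_KK n) ?_ (Measure.measurable_map _ (measurable_hAct _) hA) hB
      rw [Set.disjoint_left]
      intro x hx hx'
      apply hg _ hx
      rw [hAct_act_inv]; exact hx'

end P4a

section P5a
open Filter Topology Pointwise
open MeasureTheory ProbabilityTheory
open scoped ENNReal

section series
variable {ι : Type} {E : Type} [NormedAddCommGroup E] [InnerProductSpace ℝ E]

/-- iid standard Gaussians -/
noncomputable abbrev QQ (ι : Type) : Measure (ι → ℝ) := Measure.infinitePi (fun _ : ι => gaussianReal 0 1)

lemma memLp_coord (k : ι) : MemLp (fun ω : ι → ℝ => ω k) 2 (QQ ι) := by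
  have h := measurePreserving_eval_infinitePi (fun _ : ι => gaussianReal 0 1) k
  exact (memLp_id_gaussianReal 2).comp_measurePreserving h

lemma integral_coord_sq (k : ι) : ∫ ω : ι → ℝ, ω k * ω k ∂(QQ ι) = 1 := by
  have h := measurePreserving_eval_infinitePi (fun _ : ι => gaussianReal 0 1) k
  have h1 : ∫ ω : ι → ℝ, ω k * ω k ∂(QQ ι) = ∫ x, x * x ∂(gaussianReal 0 1) := by
    rw [← h.map_eq, integral_map h.measurable.aemeasurable (by fun_prop)]
  rw [h1]
  have h2 := variance_id_gaussianReal (μ := 0) (v := 1)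
  rw [variance_of_integral_eq_zero aemeasurable_id (by simp)] at h2
  simpa [pow_two] using h2

lemma integral_coord_mul {k l : ι} (hkl : k ≠ l) : ∫ ω : ι → ℝ, ω k * ω l ∂(QQ ι) = 0 := by
  have hi := iIndepFun_infinitePi (P := fun _ : ι => gaussianReal 0 1)
        (X := fun (n : ι) (x : ℝ) => x) (fun n => measurable_id)
  have := (hi.indepFun hkl).integral_fun_mul_eq_mul_integral
    (measurable_pi_apply k).aestronglyMeasurable (measurable_pi_apply l).aestronglyMeasurable
  rw [this]
  have h := measurePreserving_eval_infinitePi (fun _ : ι => gaussianReal 0 1) k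
  have h1 : ∫ ω : ι → ℝ, ω k ∂(QQ ι) = ∫ x, x ∂(gaussianReal 0 1) := by
    rw [← h.map_eq, integral_map h.measurable.aemeasurable (by fun_prop)]
  rw [h1]
  simp

lemma memLp_coord_smul (k : ι) (v : E) : MemLp (fun ω : ι → ℝ => ω k • v) 2 (QQ ι) :=
  ((ContinuousLinearMap.toSpanSingleton ℝ v).comp_memLp' (memLp_coord k))

lemma inner_coord_smul (k l : ι) (v w : E) :
    inner ℝ ((memLp_coord_smul k v).toLp _) ((memLp_coord_smul l w).toLp _) =
      (∫ ω : ι → ℝ, ω k * ω l ∂(QQ ι)) * inner ℝ v w := by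
  rw [L2.inner_def, ← integral_mul_const]
  refine integral_congr_ae ?_
  filter_upwards [(memLp_coord_smul k v).coeFn_toLp, (memLp_coord_smul l w).coeFn_toLp] with ω h1 h2
  rw [h1, h2, real_inner_smul_left, real_inner_smul_right]; ring

/-- isometric embedding -/
noncomputable def VVk (k : ι) : E →ₗᵢ[ℝ] Lp E 2 (QQ ι) where
  toFun v := (memLp_coord_smul k v).toLp _
  map_add' v w := by
    rw [← MemLp.toLp_add]
    congr 1; ext ω; simp
  map_smul' c v := by
    rw [RingHom.id_apply, ← MemLp.toLp_const_smul]
    congr 1; ext ω; simp [smul_comm c]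
  norm_map' v := by
    have h := inner_coord_smul k k v v
    rw [integral_coord_sq, one_mul, real_inner_self_eq_norm_sq, real_inner_self_eq_norm_sq] at h
    exact (sq_eq_sq₀ (norm_nonneg _) (norm_nonneg _)).1 h

lemma VVk_orth : OrthogonalFamily ℝ (fun _ : ι => E) (VVk (ι := ι)) := by
  intro k l hkl v w
  have h := inner_coord_smul k l v w
  rw [integral_coord_mul hkl, zero_mul] at h
  exact h

theorem exists_gauss_series [CompleteSpace E] [MeasurableSpace E] [BorelSpace E]
    (a : ι → E) (ha : Summable fun k => ‖a k‖ ^ 2) :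
    ∃ γ : Measure E, IsProbabilityMeasure γ ∧ ∀ (t : E) (s : ℝ), HasSum (fun k => inner ℝ (a k) t ^ 2) s →
      charFun γ t = Complex.exp (-(s : ℂ) / 2) := by
  classical
  have hsum : Summable fun k => VVk k (a k) :=
    (VVk_orth.summable_iff_norm_sq_summable a).2 ha
  obtain ⟨Z, hZ⟩ := hsum
  have hZm : AEStronglyMeasurable Z (QQ ι) := Lp.aestronglyMeasurable Z
  refine ⟨(QQ ι).map Z, Measure.isProbabilityMeasure_map hZm.aemeasurable, ?_⟩
  intro t s hs
  have hch : charFun ((QQ ι).map Z) t = ∫ ω, Complex.exp ((inner ℝ (Z ω) t : ℝ) * Complex.I) ∂(QQ ι) := by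
    rw [charFun_apply, integral_map hZm.aemeasurable]
    apply Continuous.aestronglyMeasurable
    fun_prop
  rw [hch]
  -- partial sums
  have hpart : ∀ u : Finset ι, ∫ ω, Complex.exp ((inner ℝ ((∑ k ∈ u, VVk k (a k) : Lp E 2 (QQ ι)) ω) t : ℝ) * Complex.I) ∂(QQ ι)
      = Complex.exp (-((∑ k ∈ u, inner ℝ (a k) t ^ 2 : ℝ) : ℂ) / 2) := by
    intro u
    have hae : ∀ᵐ ω ∂(QQ ι), (∑ k ∈ u, VVk k (a k) : Lp E 2 (QQ ι)) ω = ∑ k ∈ u, ω k • a k := by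
      have h1 : ∀ᵐ ω ∂(QQ ι), ∀ k ∈ u, (VVk k (a k) : Lp E 2 (QQ ι)) ω = ω k • a k := by
        rw [Filter.eventually_all_finset]
        intro k _
        exact (memLp_coord_smul k (a k)).coeFn_toLp
      filter_upwards [Lp.coeFn_finsetSum u (fun k => VVk k (a k)), h1] with ω h2 h3
      rw [h2, Finset.sum_apply]
      exact Finset.sum_congr rfl h3
    have e1 : ∫ ω, Complex.exp ((inner ℝ ((∑ k ∈ u, VVk k (a k) : Lp E 2 (QQ ι)) ω) t : ℝ) * Complex.I) ∂(QQ ι)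
        = ∫ ω, ∏ k : u, Complex.exp (((inner ℝ (a k) t * ω k : ℝ) : ℂ) * Complex.I) ∂(QQ ι) := by
      refine integral_congr_ae ?_
      filter_upwards [hae] with ω hω
      rw [hω, ← Complex.exp_sum, sum_inner, Finset.sum_coe_sort u (fun k => ((inner ℝ (a k) t * ω k : ℝ) : ℂ) * Complex.I)]
      simp only [real_inner_smul_left]
      push_cast
      rw [Finset.sum_mul]
      simp only [mul_comm]
    rw [e1]
    have hmk : ∀ k : ι, Measurable fun x : ℝ => Complex.exp (((inner ℝ (a k) t * x : ℝ) : ℂ) * Complex.I) := by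
      intro k; fun_prop
    have hi := iIndepFun_infinitePi (P := fun _ : ι => gaussianReal 0 1)
        (X := fun (k : ι) (x : ℝ) => Complex.exp (((inner ℝ (a k) t * x : ℝ) : ℂ) * Complex.I)) hmk
    have hi2 := hi.precomp (g := ((↑) : u → ι)) Subtype.val_injective
    have := hi2.integral_fun_prod_eq_prod_integral (fun k => ((hmk k).comp (measurable_pi_apply _)).aestronglyMeasurable)
    rw [show ∫ ω : ι → ℝ, ∏ k : u, Complex.exp (((inner ℝ (a k) t * ω k : ℝ) : ℂ) * Complex.I) ∂(QQ ι) = _ from this]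
    have hc : ∀ k : ι, ∫ ω : ι → ℝ, Complex.exp (((inner ℝ (a k) t * ω k : ℝ) : ℂ) * Complex.I) ∂(QQ ι) =
        Complex.exp (-((inner ℝ (a k) t ^ 2 : ℝ) : ℂ) / 2) := by
      intro k
      have h := measurePreserving_eval_infinitePi (fun _ : ι => gaussianReal 0 1) k
      have h1 : ∫ ω : ι → ℝ, Complex.exp (((inner ℝ (a k) t * ω k : ℝ) : ℂ) * Complex.I) ∂(QQ ι) = charFun (gaussianReal 0 1) (inner ℝ (a k) t) := by
        rw [charFun_apply_real, ← h.map_eq, integral_map h.measurable.aemeasurable (by fun_prop)]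
        push_cast; rfl
      rw [h1, charFun_gaussianReal]
      congr 1
      push_cast; ring
    rw [Finset.prod_congr rfl (fun k _ => hc k.1), ← Complex.exp_sum,
      Finset.sum_coe_sort u (fun k => -((inner ℝ (a k) t ^ 2 : ℝ) : ℂ) / 2)]
    congr 1
    push_cast
    rw [← Finset.sum_div, Finset.sum_neg_distrib]
  have t1 : Tendsto (fun u : Finset ι => Complex.exp (-((∑ k ∈ u, inner ℝ (a k) t ^ 2 : ℝ) : ℂ) / 2)) atTop
      (𝓝 (Complex.exp (-(s : ℂ) / 2))) := by
    have hc : Continuous fun r : ℝ => Complex.exp (-(r : ℂ) / 2) := by fun_prop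
    exact (hc.tendsto s).comp hs
  have t2 : Tendsto (fun u : Finset ι => ∫ ω, Complex.exp ((inner ℝ ((∑ k ∈ u, VVk k (a k) : Lp E 2 (QQ ι)) ω) t : ℝ) * Complex.I) ∂(QQ ι)) atTop
      (𝓝 (∫ ω, Complex.exp ((inner ℝ (Z ω) t : ℝ) * Complex.I) ∂(QQ ι))) := by
    rw [tendsto_iff_norm_sub_tendsto_zero]
    have hint : ∀ Y : Lp E 2 (QQ ι), Integrable (fun ω => Complex.exp ((inner ℝ (Y ω) t : ℝ) * Complex.I)) (QQ ι) := by
      intro Y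
      refine Integrable.of_bound (C := 1) ?_ ?_
      · have hc : Continuous fun y : E => Complex.exp ((inner ℝ y t : ℝ) * Complex.I) := by fun_prop
        exact hc.comp_aestronglyMeasurable (Lp.aestronglyMeasurable Y)
      · filter_upwards with ω
        rw [Complex.norm_exp_ofReal_mul_I]
    have hbound : ∀ Y : Lp E 2 (QQ ι), ‖∫ ω, Complex.exp ((inner ℝ (Y ω) t : ℝ) * Complex.I) ∂(QQ ι) - ∫ ω, Complex.exp ((inner ℝ (Z ω) t : ℝ) * Complex.I) ∂(QQ ι)‖ ≤ ‖Y - Z‖ * ‖t‖ := by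
      intro Y
      rw [← integral_sub (hint Y) (hint Z)]
      have hYZ : Integrable (fun ω => ‖(Y - Z) ω‖) (QQ ι) :=
        ((Lp.memLp (Y - Z)).integrable (by norm_num)).norm
      have hp : ∀ᵐ ω ∂(QQ ι), ‖Complex.exp ((inner ℝ (Y ω) t : ℝ) * Complex.I) - Complex.exp ((inner ℝ (Z ω) t : ℝ) * Complex.I)‖ ≤ ‖(Y - Z) ω‖ * ‖t‖ := by
        filter_upwards [Lp.coeFn_sub Y Z] with ω hω
        have h1 : ∀ x y : ℝ, ‖Complex.exp (x * Complex.I) - Complex.exp (y * Complex.I)‖ ≤ |x - y| := by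
          intro x y
          have : Complex.exp (x * Complex.I) - Complex.exp (y * Complex.I) =
              Complex.exp (y * Complex.I) * (Complex.exp (Complex.I * ((x - y : ℝ) : ℂ)) - 1) := by
            rw [mul_sub, ← Complex.exp_add, mul_one]
            congr 2; push_cast; ring
          rw [this, norm_mul, Complex.norm_exp_ofReal_mul_I, one_mul]
          exact Real.norm_exp_I_mul_ofReal_sub_one_le
        refine (h1 _ _).trans ?_
        rw [← inner_sub_left, hω, Pi.sub_apply]
        exact abs_real_inner_le_norm _ _
      calc _ ≤ ∫ ω, ‖(Y - Z) ω‖ * ‖t‖ ∂(QQ ι) := norm_integral_le_of_norm_le (hYZ.mul_const _) hp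
        _ = (∫ ω, ‖(Y - Z) ω‖ ∂(QQ ι)) * ‖t‖ := integral_mul_const _ _
        _ ≤ ‖Y - Z‖ * ‖t‖ := by
          gcongr
          rw [integral_norm_eq_lintegral_enorm (Lp.aestronglyMeasurable _), Lp.norm_def,
            ← eLpNorm_one_eq_lintegral_enorm]
          exact ENNReal.toReal_mono (Lp.eLpNorm_ne_top _) (eLpNorm_le_eLpNorm_of_exponent_le (by norm_num) (Lp.aestronglyMeasurable _))
    refine squeeze_zero (fun _ => norm_nonneg _) (fun u => hbound _) ?_
    have : Tendsto (fun u : Finset ι => ‖∑ k ∈ u, VVk k (a k) - Z‖) atTop (𝓝 0) :=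
      tendsto_iff_norm_sub_tendsto_zero.1 hZ
    simpa using this.mul_const ‖t‖
  simp only [hpart] at t2
  exact tendsto_nhds_unique t2 t1

theorem exists_gauss_op [CompleteSpace E] [MeasurableSpace E] [BorelSpace E]
    {L : Type} [NormedAddCommGroup L] [InnerProductSpace ℝ L] [CompleteSpace L]
    (b : HilbertBasis ι ℝ L) (S : L →L[ℝ] E) (hS : Summable fun k => ‖S (b k)‖ ^ 2) :
    ∃ γ : Measure E, IsProbabilityMeasure γ ∧ ∀ t : E,
      charFun γ t = Complex.exp (-((‖S.adjoint t‖ ^ 2 : ℝ) : ℂ) / 2) := by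
  obtain ⟨γ, hγ, h⟩ := exists_gauss_series (fun k => S (b k)) hS
  refine ⟨γ, hγ, fun t => h t _ ?_⟩
  have := b.hasSum_inner_mul_inner (S.adjoint t) (S.adjoint t)
  rw [real_inner_self_eq_norm_sq] at this
  have e : (fun k => inner ℝ (S (b k)) t ^ 2) =
      fun k => inner ℝ (S.adjoint t) (b k) * inner ℝ (b k) (S.adjoint t) := by
    funext k
    rw [← ContinuousLinearMap.adjoint_inner_right, real_inner_comm (b k) (S.adjoint t), pow_two]
  rw [e]
  exact this

end series
end P5a

section P6a
set_option linter.unusedSectionVars false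
open Filter Topology Pointwise
open MeasureTheory ProbabilityTheory
open scoped ENNReal RealInnerProductSpace

lemma measurable_of_dist {Ω E : Type*} {mΩ : MeasurableSpace Ω} [PseudoMetricSpace E]
    [SecondCountableTopology E]
    [MeasurableSpace E] [BorelSpace E] (f : Ω → E)
    (h : ∀ c : E, Measurable fun ω => dist (f ω) c) : Measurable f := by
  rcases isEmpty_or_nonempty E with hE | hE
  · have : IsEmpty Ω := ⟨fun ω => hE.elim (f ω)⟩
    exact measurable_of_empty f
  apply measurable_of_isOpen
  intro U hU
  have : f ⁻¹' U = ⋃ (i : ℕ) (k : ℕ) (_ : Metric.ball (TopologicalSpace.denseSeq E i) (1/(k+1 : ℝ)) ⊆ U),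
      {ω | dist (f ω) (TopologicalSpace.denseSeq E i) < 1/(k+1 : ℝ)} := by
    ext ω
    simp only [Set.mem_preimage, Set.mem_iUnion, Set.mem_ofPred_eq, exists_prop]
    constructor
    · intro hω
      obtain ⟨ε, hε, hb⟩ := Metric.isOpen_iff.1 hU _ hω
      obtain ⟨k, hk⟩ := exists_nat_one_div_lt (half_pos hε)
      have hkp : (0:ℝ) < 1/((k:ℝ)+1) := by positivity
      obtain ⟨i, hi⟩ := (TopologicalSpace.denseRange_denseSeq E).exists_dist_lt (f ω) hkp
      refine ⟨i, k, ?_, hi⟩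
      intro y hy
      apply hb
      rw [Metric.mem_ball] at hy ⊢
      have := dist_triangle_right y (f ω) (TopologicalSpace.denseSeq E i)
      linarith
    · rintro ⟨i, k, hs, hd⟩
      exact hs hd
  rw [this]
  refine MeasurableSet.iUnion fun i => MeasurableSet.iUnion fun k => MeasurableSet.iUnion fun _ => ?_
  exact measurableSet_lt (h _) measurable_const

lemma borel_le_of_inner {E : Type*} [NormedAddCommGroup E] [InnerProductSpace ℝ E]
    [SecondCountableTopology E] {mE : MeasurableSpace E} [BorelSpace E] (m : MeasurableSpace E)
    (h : ∀ t : E, Measurable[m] fun x : E => ⟪x, t⟫) : mE ≤ m := by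
  have hid : @Measurable E E m mE (id : E → E) := by
    refine @measurable_of_dist E E m _ _ mE ‹_› id ?_
    intro c
    refine @measurable_of_Iic _ _ _ _ _ m _ _ _ _ ?_
    intro r
    rcases lt_or_ge r 0 with hr | hr
    · have : (fun ω : E => dist (id ω) c) ⁻¹' Set.Iic r = ∅ := by
        ext ω; simp; exact lt_of_lt_of_le hr dist_nonneg
      rw [this]; exact @MeasurableSet.empty _ m
    have : (fun ω : E => dist (id ω) c) ⁻¹' Set.Iic r =
        ⋂ i : ℕ, {ω | ⟪ω, TopologicalSpace.denseSeq E i⟫ ≤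
          ⟪c, TopologicalSpace.denseSeq E i⟫ + r * ‖TopologicalSpace.denseSeq E i‖} := by
      ext ω
      simp only [Set.mem_preimage, Set.mem_Iic, Set.mem_iInter, Set.mem_ofPred_eq, id]
      constructor
      · intro hd i
        have := real_inner_le_norm (ω - c) (TopologicalSpace.denseSeq E i)
        rw [inner_sub_left, ← dist_eq_norm] at this
        have h2 := mul_le_mul_of_nonneg_right hd (norm_nonneg (TopologicalSpace.denseSeq E i))
        linarith
      · intro hi
        have hall : ∀ t : E, ⟪ω, t⟫ ≤ ⟪c, t⟫ + r * ‖t‖ := by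
          intro t
          have hcl : IsClosed {t : E | ⟪ω, t⟫ ≤ ⟪c, t⟫ + r * ‖t‖} :=
            isClosed_le (by fun_prop) (by fun_prop)
          have := (TopologicalSpace.denseRange_denseSeq E).closure_range
          have h3 : closure (Set.range (TopologicalSpace.denseSeq E)) ⊆
              {t : E | ⟪ω, t⟫ ≤ ⟪c, t⟫ + r * ‖t‖} :=
            closure_minimal (by rintro _ ⟨i, rfl⟩; exact hi i) hcl
          rw [this] at h3
          exact h3 (Set.mem_univ t)
        have h1 := hall (ω - c)
        have h2 : ⟪ω - c, ω - c⟫ ≤ r * ‖ω - c‖ := by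
          rw [inner_sub_left]; linarith
        rw [real_inner_self_eq_norm_mul_norm] at h2
        rw [dist_eq_norm]
        rcases (norm_nonneg (ω - c)).eq_or_lt with h0 | h0
        · rw [← h0]; exact hr
        · exact le_of_mul_le_mul_right h2 h0
    rw [this]
    refine @MeasurableSet.iInter _ _ m _ _ fun i => ?_
    exact @measurableSet_le _ _ _ _ _ m _ _ _ _ _ (h _) (@measurable_const _ _ _ m _)
  intro s hs
  exact hid hs


variable {E L : Type} [NormedAddCommGroup E] [InnerProductSpace ℝ E] [CompleteSpace E]
  [SecondCountableTopology E] [MeasurableSpace E] [BorelSpace E]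
  [NormedAddCommGroup L] [InnerProductSpace ℝ L]

lemma charFun_map_clm {F : Type} [NormedAddCommGroup F] [InnerProductSpace ℝ F] [CompleteSpace F]
    [MeasurableSpace F] [BorelSpace F] [SecondCountableTopology F]
    (γ : Measure E) (A : E →L[ℝ] F) (t : F) :
    charFun (γ.map A) t = charFun γ (A.adjoint t) := by
  rw [charFun_apply, charFun_apply, integral_map (by fun_prop) (by fun_prop)]
  simp [ContinuousLinearMap.adjoint_inner_right]

lemma law_inner (γ : Measure E) [IsProbabilityMeasure γ] (Q : E →L[ℝ] L)
    (hγ : ∀ t : E, charFun γ t = Complex.exp (-((‖Q t‖ ^ 2 : ℝ) : ℂ) / 2)) (t : E) :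
    γ.map (fun x => ⟪x, t⟫) = gaussianReal 0 (‖Q t‖₊ ^ 2) := by
  have hm : Measurable (fun x : E => ⟪x, t⟫) := by fun_prop
  have := Measure.isProbabilityMeasure_map (μ := γ) hm.aemeasurable
  apply Measure.ext_of_charFun
  ext r
  rw [charFun_gaussianReal, charFun_apply_real, integral_map hm.aemeasurable (by fun_prop)]
  have h := hγ (r • t)
  rw [charFun_apply] at h
  simp only [inner_smul_right, map_smul, norm_smul, Complex.ofReal_mul] at h
  rw [h]
  congr 1
  simp [mul_pow, ← Complex.ofReal_pow]
  ring

lemma memLp_inner (γ : Measure E) [IsProbabilityMeasure γ] (Q : E →L[ℝ] L)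
    (hγ : ∀ t : E, charFun γ t = Complex.exp (-((‖Q t‖ ^ 2 : ℝ) : ℂ) / 2)) (t : E) :
    MemLp (fun x => ⟪x, t⟫) 2 γ := by
  have hm : Measurable (fun x : E => ⟪x, t⟫) := by fun_prop
  have h := law_inner γ Q hγ t
  have h2 : MeasurePreserving (fun x : E => ⟪x, t⟫) γ (gaussianReal 0 (‖Q t‖₊ ^ 2)) := ⟨hm, h⟩
  exact (memLp_id_gaussianReal 2).comp_measurePreserving h2

noncomputable def gJ (γ : Measure E) (hmem : ∀ t : E, MemLp (fun x => ⟪x, t⟫) 2 γ) :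
    E →ₗ[ℝ] Lp ℝ 2 γ where
  toFun t := (hmem t).toLp _
  map_add' s t := by
    rw [← MemLp.toLp_add]
    congr 1
    ext x
    simp [inner_add_right]
  map_smul' c t := by
    rw [RingHom.id_apply, ← MemLp.toLp_const_smul]
    congr 1
    ext x
    simp [inner_smul_right]

lemma norm_gJ (γ : Measure E) [IsProbabilityMeasure γ] (Q : E →L[ℝ] L)
    (hγ : ∀ t : E, charFun γ t = Complex.exp (-((‖Q t‖ ^ 2 : ℝ) : ℂ) / 2))
    (hmem : ∀ t : E, MemLp (fun x => ⟪x, t⟫) 2 γ) (t : E) :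
    ‖gJ γ hmem t‖ = ‖Q t‖ := by
  have hm : Measurable (fun x : E => ⟪x, t⟫) := by fun_prop
  have h1 : ‖gJ γ hmem t‖ ^ 2 = ∫ x, ⟪x, t⟫ ^ 2 ∂γ := by
    rw [← real_inner_self_eq_norm_sq, L2.inner_def]
    apply integral_congr_ae
    filter_upwards [(hmem t).coeFn_toLp] with x hx
    simp only [gJ, LinearMap.coe_mk, AddHom.coe_mk, hx]
    simp [pow_two]
  have h2 : ∫ x, ⟪x, t⟫ ^ 2 ∂γ = ‖Q t‖ ^ 2 := by
    have h3 : ∫ x, ⟪x, t⟫ ^ 2 ∂γ = ∫ r, r ^ 2 ∂(γ.map (fun x => ⟪x, t⟫)) := by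
      rw [integral_map hm.aemeasurable (by fun_prop)]
    rw [h3, law_inner γ Q hγ t]
    have h4 := variance_id_gaussianReal (μ := 0) (v := ‖Q t‖₊ ^ 2)
    rw [variance_of_integral_eq_zero aemeasurable_id (by simp)] at h4
    simpa using h4
  rw [h2] at h1
  exact (pow_left_inj₀ (norm_nonneg _) (norm_nonneg _) two_ne_zero).1 h1

lemma law_gJ (γ : Measure E) [IsProbabilityMeasure γ] (Q : E →L[ℝ] L)
    (hγ : ∀ t : E, charFun γ t = Complex.exp (-((‖Q t‖ ^ 2 : ℝ) : ℂ) / 2))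
    (hmem : ∀ t : E, MemLp (fun x => ⟪x, t⟫) 2 γ) (t : E) :
    γ.map (gJ γ hmem t : E → ℝ) = gaussianReal 0 (‖gJ γ hmem t‖₊ ^ 2) := by
  have h : (gJ γ hmem t : E → ℝ) =ᵐ[γ] fun x => ⟪x, t⟫ := (hmem t).coeFn_toLp
  rw [Measure.map_congr h, law_inner γ Q hγ t]
  congr 2
  ext
  simp [norm_gJ γ Q hγ hmem t]

lemma gauss_invariant (γ : Measure E) [IsProbabilityMeasure γ] (Q : E →L[ℝ] L)
    (hγ : ∀ t : E, charFun γ t = Complex.exp (-((‖Q t‖ ^ 2 : ℝ) : ℂ) / 2))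
    (A : E →L[ℝ] E) (hA : ∀ t, ‖Q (A.adjoint t)‖ = ‖Q t‖) : MeasurePreserving A γ γ := by
  refine ⟨by fun_prop, ?_⟩
  have := Measure.isProbabilityMeasure_map (μ := γ) (f := A) (by fun_prop)
  apply Measure.ext_of_charFun
  ext t
  rw [charFun_map_clm, hγ, hγ, hA]

lemma gauss_indep (γ : Measure E) [IsProbabilityMeasure γ] (Q : E →L[ℝ] L)
    (hγ : ∀ t : E, charFun γ t = Complex.exp (-((‖Q t‖ ^ 2 : ℝ) : ℂ) / 2))
    (A B : E →L[ℝ] E) (hAB : ∀ s t, ⟪Q (A.adjoint s), Q (B.adjoint t)⟫ = 0) :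
    IndepFun A B γ := by
  rw [indepFun_iff_charFun_prod (by fun_prop) (by fun_prop)]
  intro t
  rw [charFun_map_clm, charFun_map_clm, hγ, hγ, ← Complex.exp_add]
  have h1 : charFun (γ.map (fun ω => WithLp.toLp 2 (A ω, B ω))) t =
      charFun γ (A.adjoint t.ofLp.1 + B.adjoint t.ofLp.2) := by
    rw [charFun_apply, charFun_apply, integral_map (by fun_prop) (by fun_prop)]
    simp [ContinuousLinearMap.adjoint_inner_right, inner_add_right, WithLp.prod_inner_apply]
  rw [h1, hγ]
  congr 1
  rw [map_add, norm_add_sq_real, hAB]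
  push_cast
  ring

end P6a

section P6b
set_option linter.unusedSectionVars false
open Filter Topology Pointwise
open MeasureTheory ProbabilityTheory
open scoped ENNReal RealInnerProductSpace

variable {E L : Type} [NormedAddCommGroup E] [InnerProductSpace ℝ E] [CompleteSpace E]
  [SecondCountableTopology E] [MeasurableSpace E] [BorelSpace E]
  [NormedAddCommGroup L] [InnerProductSpace ℝ L] [CompleteSpace L]

/-- the linear system -/
def gsys (γ : Measure E) (T : H3 → E →L[ℝ] E)
    (T_one : ∀ x, T 1 x = x) (T_mul : ∀ g h x, T (g * h) x = T g (T h x))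
    (T_meas : Measurable fun p : H3 × E => T p.1 p.2)
    (T_mp : ∀ g, MeasurePreserving (T g) γ γ) : H3System where
  X := E
  μ := γ
  T g x := T g x
  t_one := T_one
  t_mul := T_mul
  t_meas := T_meas
  t_mp := T_mp

lemma comp_gJ (γ : Measure E) (hmem : ∀ t : E, MemLp (fun x => ⟪x, t⟫) 2 γ)
    (A : E →L[ℝ] E) (hA : MeasurePreserving A γ γ) (t : E) :
    Lp.compMeasurePreserving A hA (gJ γ hmem t) = gJ γ hmem (A.adjoint t) := by
  have h : gJ γ hmem t = (hmem t).toLp _ := rfl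
  have h' : gJ γ hmem (A.adjoint t) = (hmem (A.adjoint t)).toLp _ := rfl
  rw [h, h', Lp.toLp_compMeasurePreserving]
  congr 1
  ext x
  simp [ContinuousLinearMap.adjoint_inner_right]

lemma comp_inv (γ : Measure E) (T : H3 → E →L[ℝ] E)
    (T_one : ∀ x, T 1 x = x) (T_mul : ∀ g h x, T (g * h) x = T g (T h x))
    (T_mp : ∀ g, MeasurePreserving (T g) γ γ) (g : H3) (f : Lp ℝ 2 γ) :
    Lp.compMeasurePreserving (T g) (T_mp g) (Lp.compMeasurePreserving (T g⁻¹) (T_mp g⁻¹) f) = f := by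
  apply Lp.ext
  filter_upwards [Lp.coeFn_compMeasurePreserving (Lp.compMeasurePreserving (T g⁻¹) (T_mp g⁻¹) f) (T_mp g),
    (T_mp g).quasiMeasurePreserving.ae (Lp.coeFn_compMeasurePreserving f (T_mp g⁻¹))] with x h1 h2
  rw [h1, Function.comp_apply, h2, Function.comp_apply, ← T_mul, inv_mul_cancel, T_one]

lemma comp_comp (γ : Measure E) (T : H3 → E →L[ℝ] E)
    (T_mul : ∀ g h x, T (g * h) x = T g (T h x))
    (T_mp : ∀ g, MeasurePreserving (T g) γ γ) (g h : H3) (f : Lp ℝ 2 γ) :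
    Lp.compMeasurePreserving (T g) (T_mp g) (Lp.compMeasurePreserving (T h) (T_mp h) f) =
      Lp.compMeasurePreserving (T (h * g)) (T_mp _) f := by
  apply Lp.ext
  filter_upwards [Lp.coeFn_compMeasurePreserving (Lp.compMeasurePreserving (T h) (T_mp h) f) (T_mp g),
    (T_mp g).quasiMeasurePreserving.ae (Lp.coeFn_compMeasurePreserving f (T_mp h)),
    Lp.coeFn_compMeasurePreserving f (T_mp (h * g))] with x h1 h2 h3
  rw [h1, Function.comp_apply, h2, Function.comp_apply, ← T_mul, h3, Function.comp_apply]

/-- Koopman operators on the first chaos. -/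
noncomputable def gO (γ : Measure E) (hmem : ∀ t : E, MemLp (fun x => ⟪x, t⟫) 2 γ)
    (T : H3 → E →L[ℝ] E)
    (T_one : ∀ x, T 1 x = x) (T_mul : ∀ g h x, T (g * h) x = T g (T h x))
    (T_mp : ∀ g, MeasurePreserving (T g) γ γ) (g : H3) :
    LinearMap.range (gJ γ hmem) ≃ₗᵢ[ℝ] LinearMap.range (gJ γ hmem) where
  toFun v := ⟨Lp.compMeasurePreserving (T g⁻¹) (T_mp g⁻¹) v.1, by
    obtain ⟨t, ht⟩ := v.2
    exact ⟨_, by rw [← ht]; exact (comp_gJ γ hmem _ (T_mp g⁻¹) t).symm⟩⟩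
  invFun v := ⟨Lp.compMeasurePreserving (T g) (T_mp g) v.1, by
    obtain ⟨t, ht⟩ := v.2
    exact ⟨_, by rw [← ht]; exact (comp_gJ γ hmem _ (T_mp g) t).symm⟩⟩
  left_inv v := by
    apply Subtype.ext
    exact comp_inv γ T T_one T_mul T_mp g v.1
  right_inv v := by
    apply Subtype.ext
    have := comp_inv γ T T_one T_mul T_mp g⁻¹ v.1
    simpa using this
  map_add' u v := by
    apply Subtype.ext
    exact map_add _ u.1 v.1
  map_smul' c v := by
    apply Subtype.ext
    exact map_smul (Lp.compMeasurePreservingₗᵢ ℝ (T g⁻¹) (T_mp g⁻¹)) c v.1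
  norm_map' v := (Lp.compMeasurePreservingₗᵢ ℝ (T g⁻¹) (T_mp g⁻¹)).norm_map v.1

lemma borel_le_eventually {mE : MeasurableSpace E} [BorelSpace E] (γ : Measure E)
    (f : E → E → ℝ) (hf : ∀ t, f t =ᵐ[γ] fun x => ⟪x, t⟫)
    (m : MeasurableSpace E) (hm : ∀ t, MeasurableSpace.comap (f t) inferInstance ≤ m) :
    mE ≤ eventuallyMeasurableSpace m (ae γ) := by
  apply borel_le_of_inner
  intro t
  have h1 : @Measurable E ℝ m _ (f t) := measurable_iff_comap_le.2 (hm t)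
  exact Measurable.eventuallyMeasurable_of_eventuallyEq h1 (hf t).symm

lemma gauss_data (γ : Measure E) [IsProbabilityMeasure γ] (Q : E →L[ℝ] L)
    (hγ : ∀ t : E, charFun γ t = Complex.exp (-((‖Q t‖ ^ 2 : ℝ) : ℂ) / 2))
    (hQ : ∃ t, Q t ≠ 0)
    (T : H3 → E →L[ℝ] E)
    (T_one : ∀ x, T 1 x = x) (T_mul : ∀ g h x, T (g * h) x = T g (T h x))
    (T_meas : Measurable fun p : H3 × E => T p.1 p.2)
    (T_mp : ∀ g, MeasurePreserving (T g) γ γ) :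
    Nonempty (GaussianData (gsys γ T T_one T_mul T_meas T_mp)) := by
  have hmem := memLp_inner γ Q hγ
  refine ⟨{ H := LinearMap.range (gJ γ hmem)
            nontrivial := ?_
            O := gO γ hmem T T_one T_mul T_mp
            O_mul := ?_
            xi := (LinearMap.range (gJ γ hmem)).subtypeₗᵢ
            gauss := ?_
            equiv := ?_
            generating := ?_ }⟩
  · obtain ⟨t, ht⟩ := hQ
    refine ⟨⟨gJ γ hmem t, t, rfl⟩, fun h => ht ?_⟩
    have h1 : gJ γ hmem t = 0 := congrArg Subtype.val h
    rw [← norm_eq_zero, ← norm_gJ γ Q hγ hmem t, h1, norm_zero]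
  · intro g h v
    apply Subtype.ext
    change Lp.compMeasurePreserving (T (g * h)⁻¹) _ v.1 =
      Lp.compMeasurePreserving (T g⁻¹) (T_mp g⁻¹) (Lp.compMeasurePreserving (T h⁻¹) (T_mp h⁻¹) v.1)
    rw [comp_comp γ T T_mul T_mp]
    congr 2
    simp
  · rintro ⟨v, t, rfl⟩
    exact law_gJ γ Q hγ hmem t
  · intro g v
    exact Lp.coeFn_compMeasurePreserving v.1 (T_mp g⁻¹)
  · intro A hA
    have key := borel_le_eventually γ (gJ γ hmem · : E → E → ℝ) (fun t => (hmem t).coeFn_toLp)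
      (⨆ v : LinearMap.range (gJ γ hmem),
        MeasurableSpace.comap (fun x => ((v : Lp ℝ 2 γ) : E → ℝ) x) inferInstance)
      (fun t => le_iSup (fun v : LinearMap.range (gJ γ hmem) =>
            MeasurableSpace.comap (fun x => ((v : Lp ℝ 2 γ) : E → ℝ) x) inferInstance)
            ⟨gJ γ hmem t, t, rfl⟩)
    obtain ⟨A', hA', he⟩ := key A hA
    refine ⟨A', hA', ?_⟩
    exact measure_symmDiff_eq_zero_iff.2 he

lemma gauss_abstract (S : L →L[ℝ] E) (hS0 : S ≠ 0)
    (γ : Measure E) [IsProbabilityMeasure γ]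
    (hγ : ∀ t : E, charFun γ t = Complex.exp (-((‖S.adjoint t‖ ^ 2 : ℝ) : ℂ) / 2))
    (T : H3 → E →L[ℝ] E)
    (T_one : ∀ x, T 1 x = x) (T_mul : ∀ g h x, T (g * h) x = T g (T h x))
    (T_meas : Measurable fun p : H3 × E => T p.1 p.2)
    (lam : H3 → L →L[ℝ] L) (lam_inner : ∀ g u v, ⟪lam g u, v⟫ = ⟪u, lam g⁻¹ v⟫)
    (lam_norm : ∀ g v, ‖lam g v‖ = ‖v‖)
    (hTS : ∀ g e, T g (S e) = S (lam g e))
    (R : ℕ → E →L[ℝ] E)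
    (Rmono : Monotone fun n => MeasurableSpace.comap (R n) (borel E))
    (Rgen : borel E ≤ ⨆ n, MeasurableSpace.comap (R n) (borel E))
    (M : ℕ → L →L[ℝ] L) (M_symm : ∀ n u v, ⟪M n u, v⟫ = ⟪u, M n v⟫)
    (hRM : ∀ n e, R n (S (M n e)) = R n (S e))
    (hM : ∀ n, ∀ᶠ g in cocompact H3, ∀ v, M n (lam g (M n v)) = 0) :
    ∃ p : H3System, p.IsStdProb ∧ Nonempty (GaussianData p) ∧ p.Mixing := by
  have hQT : ∀ g t, S.adjoint ((T g).adjoint t) = lam g⁻¹ (S.adjoint t) := by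
    intro g t
    refine ext_inner_left ℝ fun v => ?_
    rw [ContinuousLinearMap.adjoint_inner_right, ContinuousLinearMap.adjoint_inner_right, hTS,
      ← lam_inner, ContinuousLinearMap.adjoint_inner_right]
  have hQR : ∀ n t, S.adjoint ((R n).adjoint t) = M n (S.adjoint ((R n).adjoint t)) := by
    intro n t
    refine ext_inner_left ℝ fun v => ?_
    rw [← M_symm, ContinuousLinearMap.adjoint_inner_right, ContinuousLinearMap.adjoint_inner_right,
      ContinuousLinearMap.adjoint_inner_right, ContinuousLinearMap.adjoint_inner_right, hRM]
  have T_mp : ∀ g, MeasurePreserving (T g) γ γ := fun g =>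
    gauss_invariant γ S.adjoint hγ (T g) (fun t => by rw [hQT, lam_norm])
  have hQ0 : ∃ t, S.adjoint t ≠ 0 := by
    by_contra! h
    apply hS0
    ext e
    refine ext_inner_right ℝ fun t => ?_
    rw [← ContinuousLinearMap.adjoint_inner_right, h]
    simp
  refine ⟨gsys γ T T_one T_mul T_meas T_mp, ⟨?_, ‹_›⟩,
    gauss_data γ S.adjoint hγ hQ0 T T_one T_mul T_meas T_mp, ?_⟩
  · change StandardBorelSpace E
    infer_instance
  · change MixingFam γ (fun g x => T g x)
    have hb : ‹MeasurableSpace E› = borel E := BorelSpace.measurable_eq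
    refine mixing_of_local γ _ (fun g x => by rw [← T_mul, mul_inv_cancel, T_one]) T_mp
      (fun n => MeasurableSpace.comap (R n) (borel E)) Rmono ?_ ?_ ?_
    · intro n
      rw [← hb]
      exact measurable_iff_comap_le.1 (R n).continuous.measurable
    · rw [hb]; exact Rgen
    · intro n
      filter_upwards [hM n] with g hg
      rintro _ _ ⟨A, hA, rfl⟩ ⟨B, hB, rfl⟩
      rw [← hb] at hA hB
      have hind : IndepFun ((R n).comp (T g⁻¹)) (R n) γ := by
        refine gauss_indep γ S.adjoint hγ _ _ fun s t => ?_
        rw [ContinuousLinearMap.adjoint_comp, ContinuousLinearMap.comp_apply, hQT, hQR n s, hQR n t,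
          ← M_symm, inv_inv, hg, inner_zero_left]
      have h1 := hind.measure_inter_preimage_eq_mul A B hA hB
      have h2 : γ ((T g⁻¹) ⁻¹' ((R n) ⁻¹' A)) = γ ((R n) ⁻¹' A) :=
        (T_mp g⁻¹).measure_preimage ((R n).continuous.measurable hA).nullMeasurableSet
      rw [← h2]
      exact h1

end P6b

section P7a
set_option linter.style.haveILetI false
open Filter Topology Pointwise
open MeasureTheory ProbabilityTheory
open scoped ENNReal NNReal RealInnerProductSpace

section ops
variable {X : Type} [MeasurableSpace X] (μ : Measure X)

lemma compCLM_memLp (f : X → X) (hf : Measurable f) (C : ℝ≥0)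
    (h : μ.map f ≤ (C : ℝ≥0∞) • μ) (F : Lp ℝ 2 μ) : MemLp (fun x => F (f x)) 2 μ :=
  have hac : μ.map f ≪ μ := (Measure.absolutelyContinuous_of_le h).trans
    (Measure.smul_absolutelyContinuous)
  (memLp_map_measure_iff ((Lp.aestronglyMeasurable F).mono_ac hac) hf.aemeasurable).1
      ((Lp.memLp F).of_measure_le_smul ENNReal.coe_ne_top h)

/-- composition operator -/
noncomputable def compCLM (f : X → X) (hf : Measurable f) (C : ℝ≥0)
    (h : μ.map f ≤ (C : ℝ≥0∞) • μ) : Lp ℝ 2 μ →L[ℝ] Lp ℝ 2 μ :=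
  have hac : μ.map f ≪ μ := (Measure.absolutelyContinuous_of_le h).trans
    (Measure.smul_absolutelyContinuous)
  have hq : Measure.QuasiMeasurePreserving f μ μ := ⟨hf, hac⟩
  have hmem : ∀ F : Lp ℝ 2 μ, MemLp (fun x => F (f x)) 2 μ := compCLM_memLp μ f hf C h
  LinearMap.mkContinuous
    { toFun := fun F => (hmem F).toLp _
      map_add' := by
        intro F G
        rw [← MemLp.toLp_add, MemLp.toLp_eq_toLp_iff]
        filter_upwards [hq.ae (Lp.coeFn_add F G)] with x hx
        simpa using hx
      map_smul' := by
        intro c F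
        rw [RingHom.id_apply, ← MemLp.toLp_const_smul, MemLp.toLp_eq_toLp_iff]
        filter_upwards [hq.ae (Lp.coeFn_smul c F)] with x hx
        simpa using hx }
    ((C : ℝ) ^ (1/2 : ℝ)) (by
      intro F
      simp only [LinearMap.coe_mk, AddHom.coe_mk]
      rw [Lp.norm_toLp, Lp.norm_def]
      have h1 : eLpNorm (fun x => F (f x)) 2 μ ≤ (C : ℝ≥0∞) ^ (1/2 : ℝ) * eLpNorm F 2 μ := by
        have e1 : eLpNorm (fun x => F (f x)) 2 μ = eLpNorm F 2 (μ.map f) :=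
          (eLpNorm_map_measure ((Lp.aestronglyMeasurable F).mono_ac hac) hf.aemeasurable).symm
        rw [e1]
        refine (eLpNorm_mono_measure _ h).trans ?_
        rw [eLpNorm_smul_measure_of_ne_top (by simp)]
        simp
      have h2 := ENNReal.toReal_mono (ENNReal.mul_ne_top (by simp) (Lp.eLpNorm_ne_top F)) h1
      rw [ENNReal.toReal_mul, ← ENNReal.toReal_rpow] at h2
      simpa using h2)

lemma compCLM_coe (f : X → X) (hf : Measurable f) (C : ℝ≥0)
    (h : μ.map f ≤ (C : ℝ≥0∞) • μ) (F : Lp ℝ 2 μ) :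
    (compCLM μ f hf C h F : X → ℝ) =ᵐ[μ] fun x => F (f x) :=
  (compCLM_memLp μ f hf C h F).coeFn_toLp

/-- multiplication by an indicator -/
noncomputable def indCLM (K : Set X) (hK : MeasurableSet K) : Lp ℝ 2 μ →L[ℝ] Lp ℝ 2 μ :=
  LinearMap.mkContinuous
    { toFun := fun F => ((Lp.memLp F).indicator hK).toLp _
      map_add' := by
        intro F G
        rw [← MemLp.toLp_add, MemLp.toLp_eq_toLp_iff]
        filter_upwards [Lp.coeFn_add F G] with x hx
        rw [Pi.add_apply]
        by_cases hxK : x ∈ K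
        · rw [Set.indicator_of_mem hxK, Set.indicator_of_mem hxK, Set.indicator_of_mem hxK]
          exact hx
        · simp [hxK]
      map_smul' := by
        intro c F
        rw [RingHom.id_apply, ← MemLp.toLp_const_smul, MemLp.toLp_eq_toLp_iff]
        filter_upwards [Lp.coeFn_smul c F] with x hx
        rw [Pi.smul_apply]
        by_cases hxK : x ∈ K
        · rw [Set.indicator_of_mem hxK, Set.indicator_of_mem hxK]
          exact hx
        · simp [hxK] }
    1 (by
      intro F
      apply Lp.norm_le_mul_norm_of_ae_le_mul
      simp only [LinearMap.coe_mk, AddHom.coe_mk]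
      filter_upwards [((Lp.memLp F).indicator hK).coeFn_toLp] with x hx
      rw [hx]
      by_cases hxK : x ∈ K <;> simp [hxK])

lemma indCLM_coe (K : Set X) (hK : MeasurableSet K) (F : Lp ℝ 2 μ) :
    (indCLM μ K hK F : X → ℝ) =ᵐ[μ] K.indicator F :=
  ((Lp.memLp F).indicator hK).coeFn_toLp

lemma norm_sq_eq (F : Lp ℝ 2 μ) : ‖F‖ ^ 2 = ∫ x, F x ^ 2 ∂μ := by
  rw [← real_inner_self_eq_norm_sq, L2.inner_def]
  simp [pow_two]

lemma indCLM_symm (K : Set X) (hK : MeasurableSet K) (F G : Lp ℝ 2 μ) :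
    ⟪indCLM μ K hK F, G⟫ = ⟪F, indCLM μ K hK G⟫ := by
  rw [L2.inner_def, L2.inner_def]
  apply integral_congr_ae
  filter_upwards [indCLM_coe μ K hK F, indCLM_coe μ K hK G] with x h1 h2
  rw [h1, h2]
  by_cases hxK : x ∈ K <;> simp [hxK]

lemma indCLM_indCLM (K K' : Set X) (hK : MeasurableSet K) (hK' : MeasurableSet K') (h : K ⊆ K')
    (F : Lp ℝ 2 μ) : indCLM μ K hK (indCLM μ K' hK' F) = indCLM μ K hK F := by
  apply Lp.ext
  filter_upwards [indCLM_coe μ K hK F, indCLM_coe μ K' hK' F,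
    indCLM_coe μ K hK (indCLM μ K' hK' F)] with x h1 h2 h3
  rw [h1, h3]
  by_cases hxK : x ∈ K
  · simp [hxK, h2, h hxK]
  · simp [hxK]

lemma norm_indCLM_tendsto (K : ℕ → Set X) (hK : ∀ n, MeasurableSet (K n)) (hm : Monotone K)
    (hu : ⋃ n, K n = Set.univ) (F : Lp ℝ 2 μ) :
    Tendsto (fun n => ‖indCLM μ (K n) (hK n) F‖) atTop (𝓝 ‖F‖) := by
  have h1 : ∀ n, ‖indCLM μ (K n) (hK n) F‖ ^ 2 = ∫ x in K n, F x ^ 2 ∂μ := by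
    intro n
    rw [norm_sq_eq, ← integral_indicator (hK n)]
    apply integral_congr_ae
    filter_upwards [indCLM_coe μ (K n) (hK n) F] with x hx
    rw [hx]
    by_cases hxK : x ∈ K n <;> simp [hxK]
  have h2 := tendsto_setIntegral_of_monotone (f := fun x => F x ^ 2) (μ := μ) hK hm
    ((Lp.memLp F).integrable_sq.integrableOn)
  rw [hu, Measure.restrict_univ, ← norm_sq_eq] at h2
  simp_rw [← h1] at h2
  have h3 := h2.sqrt
  simpa using h3

lemma ind_gen [SecondCountableTopology (Lp ℝ 2 μ)]
    (K : ℕ → Set X) (hK : ∀ n, MeasurableSet (K n)) (hm : Monotone K)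
    (hu : ⋃ n, K n = Set.univ) :
    borel (Lp ℝ 2 μ) ≤ ⨆ n, MeasurableSpace.comap (indCLM μ (K n) (hK n)) (borel (Lp ℝ 2 μ)) := by
  set m := ⨆ n, MeasurableSpace.comap (indCLM μ (K n) (hK n)) (borel (Lp ℝ 2 μ)) with hmdef
  have hid : @Measurable (Lp ℝ 2 μ) (Lp ℝ 2 μ) m (borel _) id := by
    refine @measurable_of_dist _ _ m _ _ (borel _) (@BorelSpace.mk _ _ (borel _) rfl) id ?_
    intro c
    have ht : ∀ F : Lp ℝ 2 μ, Tendsto (fun n => ‖indCLM μ (K n) (hK n) F - indCLM μ (K n) (hK n) c‖)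
        atTop (𝓝 (dist (id F) c)) := by
      intro F
      have := norm_indCLM_tendsto μ K hK hm hu (F - c)
      simp only [map_sub] at this
      rw [id, dist_eq_norm]
      exact this
    refine @measurable_of_tendsto_metrizable _ _ m _ _ _ _ _ _ ?_ (tendsto_pi_nhds.2 ht)
    intro n
    have h1 : @Measurable _ _ m (borel _) (indCLM μ (K n) (hK n)) :=
      measurable_iff_comap_le.2 (le_iSup (fun n =>
        MeasurableSpace.comap (indCLM μ (K n) (hK n)) (borel (Lp ℝ 2 μ))) n)
    have h2 : @Measurable _ _ (borel (Lp ℝ 2 μ)) _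
        (fun F : Lp ℝ 2 μ => ‖F - indCLM μ (K n) (hK n) c‖) := by
      letI : MeasurableSpace (Lp ℝ 2 μ) := borel _
      haveI : BorelSpace (Lp ℝ 2 μ) := ⟨rfl⟩
      have : Continuous (fun F : Lp ℝ 2 μ => ‖F - indCLM μ (K n) (hK n) c‖) := by fun_prop
      exact this.measurable
    exact @Measurable.comp _ _ _ m (borel _) _ (fun F : Lp ℝ 2 μ => ‖F - indCLM μ (K n) (hK n) c‖) _ h2 h1
  intro s hs
  exact hid hs

lemma ind_mono (K : ℕ → Set X) (hK : ∀ n, MeasurableSet (K n)) (hm : Monotone K) :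
    Monotone fun n => MeasurableSpace.comap (indCLM μ (K n) (hK n)) (borel (Lp ℝ 2 μ)) := by
  intro n k hnk
  have h : (indCLM μ (K n) (hK n) : Lp ℝ 2 μ → Lp ℝ 2 μ) =
      indCLM μ (K n) (hK n) ∘ indCLM μ (K k) (hK k) := by
    ext1 F
    exact (indCLM_indCLM μ _ _ (hK n) (hK k) (hm hnk) F).symm
  change MeasurableSpace.comap _ _ ≤ MeasurableSpace.comap _ _
  rw [h, ← MeasurableSpace.comap_comp]
  apply MeasurableSpace.comap_mono
  letI : MeasurableSpace (Lp ℝ 2 μ) := borel _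
  haveI : BorelSpace (Lp ℝ 2 μ) := ⟨rfl⟩
  exact measurable_iff_comap_le.1 (indCLM μ (K n) (hK n)).continuous.measurable

end ops
end P7a

section P8a
set_option linter.style.haveILetI false
open Filter Topology Pointwise
open MeasureTheory ProbabilityTheory
open scoped ENNReal NNReal RealInnerProductSpace

/-- the weight -/
noncomputable def wt (x : VV) : ℝ≥0 := ((1 + ‖x‖₊) ^ 4)⁻¹

lemma measurable_wt : Measurable wt := by
  unfold wt; fun_prop

/-- a finite measure equivalent to the volume -/
noncomputable def mW : Measure VV := volume.withDensity (fun x => (wt x : ℝ≥0∞))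

lemma haar_VV : (volume : Measure VV).IsAddHaarMeasure := by
  have h2 : (volume : Measure (ℝ × ℝ)).IsAddHaarMeasure := by
    rw [Measure.volume_eq_prod]; infer_instance
  have : (volume : Measure VV) = (volume : Measure ℝ).prod (volume : Measure (ℝ × ℝ)) :=
    Measure.volume_eq_prod _ _
  rw [this]
  infer_instance

instance : IsFiniteMeasure mW := by
  have := haar_VV
  have h : Integrable (fun x : VV => (1 + ‖x‖) ^ (-(4:ℝ))) volume :=
    integrable_one_add_norm (by simp [Module.finrank_prod]; norm_num)
  have h2 := h.hasFiniteIntegral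
  rw [HasFiniteIntegral] at h2
  refine isFiniteMeasure_withDensity ?_
  refine ne_of_lt (lt_of_le_of_lt (lintegral_mono fun x => ?_) h2)
  have : ‖(1 + ‖x‖) ^ (-(4:ℝ))‖ₑ = (wt x : ℝ≥0∞) := by
    rw [← ofReal_norm, Real.norm_of_nonneg (by positivity), ← ENNReal.ofReal_coe_nnreal]
    congr 1
    rw [Real.rpow_neg (by positivity)]
    simp [wt]
  rw [this]

lemma volume_ac_mW : (volume : Measure VV) ≪ mW := by
  apply withDensity_absolutelyContinuous'
  · exact measurable_wt.coe_nnreal_ennreal.aemeasurable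
  · refine Eventually.of_forall fun x => ?_
    simp [wt]

lemma mW_ac_volume : mW ≪ (volume : Measure VV) := withDensity_absolutelyContinuous _ _

lemma exists_map_mW_le (g : H3) : ∃ C : ℝ≥0, mW.map (hAct g) ≤ (C : ℝ≥0∞) • mW := by
  set c : ℝ≥0 := 1 + ‖g.a‖₊ + ‖g.b‖₊ + ‖g.c‖₊ with hc
  have h1 : ∀ x, 1 + ‖hAct g x‖₊ ≤ c * (1 + ‖x‖₊) := by
    intro x
    rw [← NNReal.coe_le_coe]
    push_cast [hc]
    have h1 : |x.1| ≤ ‖x‖ := norm_fst_le x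
    have h2 : |x.2.1| ≤ ‖x‖ := (norm_fst_le x.2).trans (norm_snd_le x)
    have h3 : |x.2.2| ≤ ‖x‖ := (norm_snd_le x.2).trans (norm_snd_le x)
    simp only [hAct, Prod.norm_def, Real.norm_eq_abs] at h1 h2 h3 ⊢
    set N := |x.1| ⊔ (|x.2.1| ⊔ |x.2.2|)
    have hN : 0 ≤ N := (abs_nonneg _).trans h1
    have ha := abs_nonneg g.a
    have hb := abs_nonneg g.b
    have hcc := abs_nonneg g.c
    have e1 := abs_add_le g.a x.1
    have e2 := abs_add_le g.b x.2.1
    have e3 := abs_add_three g.c x.2.2 (g.a * x.2.1)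
    rw [abs_mul] at e3
    have e4 := mul_le_mul_of_nonneg_left h2 ha
    have p1 := mul_nonneg ha hN
    have p2 := mul_nonneg hb hN
    have p3 := mul_nonneg hcc hN
    rw [← le_sub_iff_add_le', sup_le_iff, sup_le_iff]
    refine ⟨?_, ?_, ?_⟩ <;> nlinarith
  have hc0 : c ≠ 0 := by positivity
  have h2 : ∀ x, wt x ≤ c ^ 4 * wt (hAct g x) := by
    intro x
    have := pow_le_pow_left₀ zero_le (h1 x) 4
    unfold wt
    rw [mul_pow] at this
    rw [← div_eq_mul_inv, le_div_iff₀ (by positivity), mul_comm, ← div_eq_mul_inv,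
      div_le_iff₀ (by positivity)]
    exact this
  refine ⟨c ^ 4, ?_⟩
  rw [Measure.le_iff]
  intro s hs
  rw [Measure.map_apply (measurable_hAct g) hs, mW, withDensity_apply _ (measurable_hAct g hs),
    Measure.smul_apply, withDensity_apply _ hs, smul_eq_mul,
    ← lintegral_const_mul _ measurable_wt.coe_nnreal_ennreal,
    ← lintegral_indicator hs, ← lintegral_indicator (measurable_hAct g hs)]
  rw [← (mp_hAct g).lintegral_comp (f := s.indicator (fun a => ((c ^ 4 : ℝ≥0) : ℝ≥0∞) * (wt a : ℝ≥0∞)))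
    ((measurable_wt.coe_nnreal_ennreal.const_mul _).indicator hs)]
  refine lintegral_mono fun x => ?_
  by_cases hx : hAct g x ∈ s
  · rw [Set.indicator_of_mem (show x ∈ hAct g ⁻¹' s from hx), Set.indicator_of_mem hx]
    have := ENNReal.coe_le_coe.2 (h2 x)
    rwa [ENNReal.coe_mul] at this
  · rw [Set.indicator_of_notMem (show x ∉ hAct g ⁻¹' s from hx)]
    exact zero_le

instance fact_two_ne_top : Fact ((2 : ℝ≥0∞) ≠ ⊤) := ⟨by simp⟩

instance : SecondCountableTopology (Lp ℝ 2 mW) := by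
  have h1 : MeasurableSpace.CountablyGenerated VV := inferInstance
  have h2 : SFinite mW := inferInstance
  have h3 : MeasureTheory.IsSeparable mW := inferInstance
  exact Lp.SecondCountableTopology

noncomputable def cG (g : H3) : ℝ≥0 := (exists_map_mW_le g).choose

/-- The action on `L²(mW)`. -/
noncomputable def TT (g : H3) : Lp ℝ 2 mW →L[ℝ] Lp ℝ 2 mW :=
  compCLM mW (hAct g⁻¹) (measurable_hAct g⁻¹) (cG g⁻¹) (exists_map_mW_le g⁻¹).choose_spec

lemma TT_coe (g : H3) (F : Lp ℝ 2 mW) :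
    (TT g F : VV → ℝ) =ᵐ[mW] fun x => F (hAct g⁻¹ x) := compCLM_coe _ _ _ _ _ _

lemma qmp_hAct (g : H3) : Measure.QuasiMeasurePreserving (hAct g) mW mW :=
  ⟨measurable_hAct g, (Measure.absolutelyContinuous_of_le (exists_map_mW_le g).choose_spec).trans
    (Measure.smul_absolutelyContinuous)⟩

lemma TT_one (F : Lp ℝ 2 mW) : TT 1 F = F := by
  apply Lp.ext
  filter_upwards [TT_coe 1 F] with x hx
  rw [hx, inv_one, hAct_one]

lemma TT_mul (g h : H3) (F : Lp ℝ 2 mW) : TT (g * h) F = TT g (TT h F) := by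
  apply Lp.ext
  filter_upwards [TT_coe (g * h) F, TT_coe g (TT h F), (qmp_hAct g⁻¹).ae (TT_coe h F)]
    with x h1 h2 h3
  rw [h1, h2, h3, mul_inv_rev, hAct_mul]

lemma TT_meas [MeasurableSpace (Lp ℝ 2 mW)] [BorelSpace (Lp ℝ 2 mW)] :
    Measurable fun p : H3 × Lp ℝ 2 mW => TT p.1 p.2 := by
  have key : ∀ F : Lp ℝ 2 mW, Measurable fun g : H3 => TT g F := by
    intro F
    apply measurable_of_dist
    intro c
    have h1 : ∀ g : H3, dist (TT g F) c = √(∫ x, (F (hAct g⁻¹ x) - c x) ^ 2 ∂mW) := by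
      intro g
      rw [dist_eq_norm, ← Real.sqrt_sq (norm_nonneg _), norm_sq_eq]
      congr 1
      apply integral_congr_ae
      filter_upwards [TT_coe g F, Lp.coeFn_sub (TT g F) c] with x h1 h2
      rw [h2, Pi.sub_apply, h1]
    simp_rw [h1]
    have h2 : StronglyMeasurable (fun p : H3 × VV => (F (hAct p.1⁻¹ p.2) - c p.2) ^ 2) := by
      apply Measurable.stronglyMeasurable
      have hF := (Lp.stronglyMeasurable F).measurable
      have hc := (Lp.stronglyMeasurable c).measurable
      have e1 : Measurable fun p : H3 × VV => hAct p.1⁻¹ p.2 :=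
        measurable_hAct_joint.comp ((measurable_H3_inv.comp measurable_fst).prodMk measurable_snd)
      exact ((hF.comp e1).sub (hc.comp measurable_snd)).pow_const 2
    exact (h2.integral_prod_right (ν := mW)).measurable.sqrt
  have h := measurable_uncurry_of_continuous_of_measurable
    (u := fun (F : Lp ℝ 2 mW) (g : H3) => TT g F) (fun g => (TT g).continuous) key
  exact h.comp measurable_swap

/-- The action on `L²(volume)`. -/
noncomputable def lamV (g : H3) : Lp ℝ 2 (volume : Measure VV) →L[ℝ] Lp ℝ 2 (volume : Measure VV) :=
  compCLM volume (hAct g⁻¹) (measurable_hAct g⁻¹) 1 (by simp [(mp_hAct g⁻¹).map_eq])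

lemma lamV_coe (g : H3) (F : Lp ℝ 2 (volume : Measure VV)) :
    (lamV g F : VV → ℝ) =ᵐ[volume] fun x => F (hAct g⁻¹ x) := compCLM_coe _ _ _ _ _ _

lemma emb_hAct (g : H3) : MeasurableEmbedding (hAct g) := by
  have e : VV ≃ᵐ VV :=
    { toFun := hAct g, invFun := hAct g⁻¹, left_inv := hAct_inv_act g, right_inv := hAct_act_inv g,
      measurable_toFun := measurable_hAct g, measurable_invFun := measurable_hAct g⁻¹ }
  exact (MeasurableEquiv.mk (Equiv.mk (hAct g) (hAct g⁻¹) (hAct_inv_act g) (hAct_act_inv g))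
    (measurable_hAct g) (measurable_hAct g⁻¹)).measurableEmbedding

lemma lamV_norm (g : H3) (F : Lp ℝ 2 (volume : Measure VV)) : ‖lamV g F‖ = ‖F‖ := by
  have h : ‖lamV g F‖ ^ 2 = ‖F‖ ^ 2 := by
    rw [norm_sq_eq, norm_sq_eq,
      ← (mp_hAct g⁻¹).integral_comp (emb_hAct g⁻¹) (fun x => F x ^ 2)]
    apply integral_congr_ae
    filter_upwards [lamV_coe g F] with x hx
    rw [hx]
  exact (pow_left_inj₀ (norm_nonneg _) (norm_nonneg _) two_ne_zero).1 h

lemma lamV_inner (g : H3) (F G : Lp ℝ 2 (volume : Measure VV)) :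
    ⟪lamV g F, G⟫ = ⟪F, lamV g⁻¹ G⟫ := by
  rw [L2.inner_def, L2.inner_def, ← (mp_hAct g).integral_comp (emb_hAct g)]
  apply integral_congr_ae
  filter_upwards [(mp_hAct g).quasiMeasurePreserving.ae (lamV_coe g F), lamV_coe g⁻¹ G] with x h1 h2
  rw [h1, h2, inv_inv, hAct_inv_act]

end P8a

section P9a
set_option linter.style.haveILetI false
open Filter Topology Pointwise
open MeasureTheory ProbabilityTheory
open scoped ENNReal NNReal RealInnerProductSpace

/-- The window attached to a point. -/
def win (x : VV) : Set VV := hAct (H3.ofProd x)⁻¹ ⁻¹' KK 1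

lemma measurableSet_win (x : VV) : MeasurableSet (win x) :=
  measurable_hAct _ (measurableSet_KK 1)

lemma volume_win (x : VV) : volume (win x) = volume (KK 1) :=
  (mp_hAct _).measure_preimage (measurableSet_KK 1).nullMeasurableSet

lemma volume_win_ne (x : VV) : volume (win x) ≠ ⊤ := by
  rw [volume_win]; exact (volume_KK 1).ne

lemma win_hAct (g : H3) (x : VV) : win (hAct g x) = hAct g⁻¹ ⁻¹' win x := by
  have : H3.ofProd (hAct g x) = g * H3.ofProd x := by
    ext <;> simp [H3.ofProd, hAct]
  ext z
  simp only [win, Set.mem_preimage, this, mul_inv_rev, hAct_mul]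

lemma win_subset (n : ℕ) (x : VV) (hx : x ∈ KK n) : win x ⊆ KK (2 * n + 1) := by
  intro z hz
  obtain ⟨w, hw, rfl⟩ : ∃ w ∈ KK 1, hAct (H3.ofProd x) w = z := ⟨_, hz, hAct_act_inv _ _⟩
  rw [mem_KK] at hx hw ⊢
  obtain ⟨x1, x2, x3⟩ := hx
  obtain ⟨w1, w2, w3⟩ := hw
  simp only [hAct, H3.ofProd]
  push_cast at *
  have hn : (0:ℝ) ≤ n := Nat.cast_nonneg n
  have e1 := abs_add_le x.1 w.1
  have e2 := abs_add_le x.2.1 w.2.1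
  have e3 := abs_add_three x.2.2 w.2.2 (x.1 * w.2.1)
  rw [abs_mul] at e3
  have e4 : |x.1| * |w.2.1| ≤ n * 1 := mul_le_mul x1 w2 (abs_nonneg _) hn
  refine ⟨?_, ?_, ?_⟩ <;> linarith

noncomputable def phiW (x : VV) : Lp ℝ 2 (volume : Measure VV) :=
  indicatorConstLp 2 (measurableSet_win x) (volume_win_ne x) 1

lemma inner_phiW (x : VV) (e : Lp ℝ 2 (volume : Measure VV)) :
    ⟪phiW x, e⟫ = ∫ z in win x, e z := L2.inner_indicatorConstLp_one _ _ _

noncomputable def cW : ℝ := ‖phiW 0‖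

lemma norm_phiW (x : VV) : ‖phiW x‖ = cW := by
  rw [cW, phiW, phiW, norm_indicatorConstLp (by simp) (by simp),
    norm_indicatorConstLp (by simp) (by simp), Measure.real, Measure.real, volume_win, volume_win]

lemma measurable_phiW (e : Lp ℝ 2 (volume : Measure VV)) : Measurable fun x => ⟪phiW x, e⟫ := by
  simp_rw [inner_phiW]
  have h1 : ∀ x, ∫ z in win x, e z = ∫ z, (KK 1).indicator (fun _ => (1:ℝ)) (hAct (H3.ofProd x)⁻¹ z) * e z := by
    intro x
    rw [← integral_indicator (measurableSet_win x)]
    congr 1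
    ext z
    by_cases hz : hAct (H3.ofProd x)⁻¹ z ∈ KK 1
    · rw [Set.indicator_of_mem (show z ∈ win x from hz), Set.indicator_of_mem hz, one_mul]
    · rw [Set.indicator_of_notMem (show z ∉ win x from hz), Set.indicator_of_notMem hz, zero_mul]
  simp_rw [h1]
  have h2 : StronglyMeasurable (fun p : VV × VV =>
      (KK 1).indicator (fun _ => (1:ℝ)) (hAct (H3.ofProd p.1)⁻¹ p.2) * e p.2) := by
    apply Measurable.stronglyMeasurable
    have hF := (Lp.stronglyMeasurable e).measurable
    have e1 : Measurable fun p : VV × VV => hAct (H3.ofProd p.1)⁻¹ p.2 :=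
      measurable_hAct_joint.comp ((measurable_H3_inv.comp
        (measurable_H3_ofProd.comp measurable_fst)).prodMk measurable_snd)
    exact (((measurable_const (a := (1:ℝ))).indicator (measurableSet_KK 1)).comp e1).mul
      (hF.comp measurable_snd)
  exact (h2.integral_prod_right (ν := volume)).measurable

lemma bound_phiW (e : Lp ℝ 2 (volume : Measure VV)) (x : VV) : ‖⟪phiW x, e⟫‖ ≤ cW * ‖e‖ := by
  rw [← norm_phiW x]
  exact norm_inner_le_norm _ _

lemma memLp_phiW (e : Lp ℝ 2 (volume : Measure VV)) : MemLp (fun x => ⟪phiW x, e⟫) 2 mW :=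
  MemLp.of_bound (measurable_phiW e).aestronglyMeasurable (cW * ‖e‖)
    (Eventually.of_forall (bound_phiW e))

noncomputable def SW : Lp ℝ 2 (volume : Measure VV) →L[ℝ] Lp ℝ 2 mW :=
  LinearMap.mkContinuous
    { toFun := fun e => (memLp_phiW e).toLp _
      map_add' := by
        intro e f
        rw [← MemLp.toLp_add]
        congr 1
        ext x
        simp [inner_add_right]
      map_smul' := by
        intro c e
        rw [RingHom.id_apply, ← MemLp.toLp_const_smul]
        congr 1
        ext x
        simp [inner_smul_right] }
    ((measureUnivNNReal mW : ℝ) ^ ((2 : ℝ≥0∞).toReal⁻¹) * cW) (by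
      intro e
      rw [mul_assoc]
      apply Lp.norm_le_of_ae_bound (mul_nonneg (norm_nonneg _) (norm_nonneg _))
      simp only [LinearMap.coe_mk, AddHom.coe_mk]
      filter_upwards [(memLp_phiW e).coeFn_toLp] with x hx
      rw [hx]
      exact bound_phiW e x)

lemma SW_coe (e : Lp ℝ 2 (volume : Measure VV)) :
    (SW e : VV → ℝ) =ᵐ[mW] fun x => ⟪phiW x, e⟫ := (memLp_phiW e).coeFn_toLp

lemma SW_summable {ι : Type} (b : HilbertBasis ι ℝ (Lp ℝ 2 (volume : Measure VV))) :
    Summable fun k => ‖SW (b k)‖ ^ 2 := by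
  apply summable_of_sum_le (c := ∫ _, cW ^ 2 ∂mW) (fun k => by positivity)
  intro s
  have h1 : ∀ k, ‖SW (b k)‖ ^ 2 = ∫ x, ⟪phiW x, b k⟫ ^ 2 ∂mW := by
    intro k
    rw [norm_sq_eq]
    apply integral_congr_ae
    filter_upwards [SW_coe (b k)] with x hx
    rw [hx]
  simp_rw [h1]
  rw [← integral_finsetSum _ (fun k _ => (memLp_phiW (b k)).integrable_sq)]
  apply integral_mono (integrable_finsetSum _ (fun k _ => (memLp_phiW (b k)).integrable_sq))
    (integrable_const _)
  intro x
  have h2 := b.orthonormal.sum_inner_products_le (phiW x) (s := s)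
  rw [norm_phiW] at h2
  refine le_trans (le_of_eq ?_) h2
  refine Finset.sum_congr rfl fun k _ => ?_
  rw [real_inner_comm, Real.norm_eq_abs, sq_abs]

lemma phiW_lamV (g : H3) (x : VV) (e : Lp ℝ 2 (volume : Measure VV)) :
    ⟪phiW (hAct g⁻¹ x), e⟫ = ⟪phiW x, lamV g e⟫ := by
  rw [inner_phiW, inner_phiW, win_hAct, inv_inv, ← integral_indicator (measurableSet_win x),
    ← integral_indicator (measurable_hAct g (measurableSet_win x)),
    ← (mp_hAct g).integral_comp (emb_hAct g) ((win x).indicator (lamV g e : VV → ℝ))]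
  apply integral_congr_ae
  filter_upwards [(mp_hAct g).quasiMeasurePreserving.ae (lamV_coe g e)] with z hz
  by_cases h : hAct g z ∈ win x
  · rw [Set.indicator_of_mem (show z ∈ hAct g ⁻¹' win x from h), Set.indicator_of_mem h, hz,
      hAct_inv_act]
  · rw [Set.indicator_of_notMem (show z ∉ hAct g ⁻¹' win x from h), Set.indicator_of_notMem h]

lemma TT_SW (g : H3) (e : Lp ℝ 2 (volume : Measure VV)) : TT g (SW e) = SW (lamV g e) := by
  apply Lp.ext
  filter_upwards [TT_coe g (SW e), (qmp_hAct g⁻¹).ae (SW_coe e), SW_coe (lamV g e)] with x h1 h2 h3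
  rw [h1, h2, h3, phiW_lamV]

lemma phiW_ind (n : ℕ) (x : VV) (hx : x ∈ KK n) (e : Lp ℝ 2 (volume : Measure VV)) :
    ⟪phiW x, indCLM volume (KK (2 * n + 1)) (measurableSet_KK _) e⟫ = ⟪phiW x, e⟫ := by
  rw [inner_phiW, inner_phiW]
  apply setIntegral_congr_ae (measurableSet_win x)
  filter_upwards [indCLM_coe volume (KK (2 * n + 1)) (measurableSet_KK _) e] with z hz hzw
  rw [hz, Set.indicator_of_mem (win_subset n x hx hzw)]

lemma SW_ne : SW ≠ 0 := by
  intro h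
  let e : Lp ℝ 2 (volume : Measure VV) :=
    indicatorConstLp 2 (measurableSet_KK 3) (volume_KK 3).ne 1
  have h1 : ∀ᵐ x ∂mW, ⟪phiW x, e⟫ = 0 := by
    have h0 : SW e = 0 := by rw [h]; rfl
    filter_upwards [SW_coe e, Lp.coeFn_zero ℝ 2 mW] with x hx hx0
    rw [← hx, h0, hx0]; rfl
  have h2 : ∀ x ∈ KK 1, ⟪phiW x, e⟫ ≠ 0 := by
    intro x hx
    rw [inner_phiW]
    have h3 : ∫ z in win x, e z = ∫ z in win x, (1:ℝ) := by
      apply setIntegral_congr_ae (measurableSet_win x)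
      filter_upwards [indicatorConstLp_coeFn (p := 2) (hs := measurableSet_KK 3)
        (hμs := (volume_KK 3).ne) (c := (1:ℝ))] with z hz hzw
      rw [hz, Set.indicator_of_mem (win_subset 1 x hx hzw)]
    rw [h3]
    simp only [integral_const, smul_eq_mul, mul_one, measureReal_restrict_apply_univ]
    rw [Measure.real, volume_win]
    refine (ENNReal.toReal_pos ?_ (volume_KK 1).ne).ne'
    have := haar_VV
    exact (Metric.measure_closedBall_pos volume (0:VV) (by norm_num)).ne'
  have h4 : mW (KK 1) = 0 := by
    refine measure_mono_null ?_ h1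
    intro x hx hx'
    exact h2 x hx hx'
  have h5 := volume_ac_mW h4
  have := haar_VV
  exact (Metric.measure_closedBall_pos volume (0:VV) (by norm_num : (0:ℝ) < ((1:ℕ):ℝ))).ne' h5

theorem exists_mixing_gaussian :
    ∃ p : H3System, p.IsStdProb ∧ Nonempty (GaussianData p) ∧ p.Mixing := by
  letI : MeasurableSpace (Lp ℝ 2 mW) := borel _
  haveI : BorelSpace (Lp ℝ 2 mW) := ⟨rfl⟩
  obtain ⟨w, b, -⟩ := exists_hilbertBasis ℝ (Lp ℝ 2 (volume : Measure VV))
  obtain ⟨γ, hγp, hγ⟩ := exists_gauss_op b SW (SW_summable b)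
  refine gauss_abstract SW SW_ne γ hγ TT TT_one TT_mul TT_meas lamV lamV_inner lamV_norm TT_SW
    (fun n => indCLM mW (KK n) (measurableSet_KK n))
    (ind_mono mW KK measurableSet_KK KK_mono)
    (ind_gen mW KK measurableSet_KK KK_mono iUnion_KK)
    (fun n => indCLM volume (KK (2 * n + 1)) (measurableSet_KK _))
    (fun n => indCLM_symm _ _ _) ?_ ?_
  · intro n e
    apply Lp.ext
    filter_upwards [indCLM_coe mW (KK n) (measurableSet_KK n) (SW e),
      indCLM_coe mW (KK n) (measurableSet_KK n)
        (SW (indCLM volume (KK (2 * n + 1)) (measurableSet_KK _) e)), SW_coe e,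
      SW_coe (indCLM volume (KK (2 * n + 1)) (measurableSet_KK _) e)] with x h1 h2 h3 h4
    rw [h1, h2]
    by_cases hx : x ∈ KK n
    · rw [Set.indicator_of_mem hx, Set.indicator_of_mem hx, h3, h4, phiW_ind n x hx]
    · rw [Set.indicator_of_notMem hx, Set.indicator_of_notMem hx]
  · intro n
    filter_upwards [eventually_disjoint_KK (2 * n + 1)] with g hg v
    apply Lp.ext
    filter_upwards [indCLM_coe volume (KK (2 * n + 1)) (measurableSet_KK _)
        (lamV g (indCLM volume (KK (2 * n + 1)) (measurableSet_KK _) v)),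
      lamV_coe g (indCLM volume (KK (2 * n + 1)) (measurableSet_KK _) v),
      (mp_hAct g⁻¹).quasiMeasurePreserving.ae
        (indCLM_coe volume (KK (2 * n + 1)) (measurableSet_KK _) v),
      Lp.coeFn_zero ℝ 2 (volume : Measure VV)] with z h1 h2 h3 h0
    rw [h0, h1, Pi.zero_apply]
    by_cases hz : z ∈ KK (2 * n + 1)
    · rw [Set.indicator_of_mem hz, h2, h3, Set.indicator_of_notMem]
      intro hc
      have := hg _ hc
      rw [hAct_act_inv] at this
      exact this hz
    · rw [Set.indicator_of_notMem hz]

end P9a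

section Statement
open MeasureTheory

/-- **Corollary 0.3.** There exist mixing Poisson and mixing Gaussian (probability
preserving) actions of `H₃(ℝ)`: there is an infinite-measure-preserving action of `H₃(ℝ)`
whose Poisson suspension is a mixing probability-preserving action, and there is a mixing
Gaussian probability-preserving action of `H₃(ℝ)`. -/
theorem exists_mixing_poisson_and_gaussian_actions :
    (∃ s : H3System, StandardBorelSpace s.X ∧ SigmaFinite s.μ ∧ s.μ Set.univ = ⊤ ∧
      NoAtoms s.μ ∧
      ∃ P : Measure (Measure s.X), IsPoissonSuspensionMeasure s P ∧
        (∀ g : H3, MeasurePreserving (fun ω : Measure s.X => ω.map (s.T g)) P P) ∧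
        MixingFam P fun g ω => ω.map (s.T g)) ∧
    (∃ p : H3System, p.IsStdProb ∧ Nonempty (GaussianData p) ∧ p.Mixing) := by
  exact ⟨exists_mixing_poisson, exists_mixing_gaussian⟩

end Statement
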